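/- arXiv:1808.10227 — 3 statements merged into one kernel-verified Lean document; each statement's English description precedes it below -/
import Mathlib

section
/- The Rado graph has finite big Ramsey degrees: for every finite simple graph G there exists a natural number T(G) such that the following holds. Let R be a simple graph on vertex set ℕ satisfying the extension property. For every r ≥ 1 and every coloring c of the set of induced copies of G in R with r colors, there exists a set S ⊆ ℕ such that the induced subgraph of R on S again satisfies the extension property (with respect to vertices in S), and the set of colors taken by c on induced copies of G whose vertex set is contained in S has cardinality at most T(G). -/
/-- A simple graph on `ℕ` satisfies the extension property if for all disjoint finite
sets `A, B ⊆ ℕ` there is a vertex `v ∉ A ∪ B` adjacent to every vertex of `A` and to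
no vertex of `B`. -/
def ExtensionProperty (R : SimpleGraph ℕ) : Prop :=
  ∀ A B : Finset ℕ, Disjoint A B →
    ∃ v, v ∉ A ∧ v ∉ B ∧ (∀ a ∈ A, R.Adj v a) ∧ ∀ b ∈ B, ¬ R.Adj v b

/-- The induced subgraph of `R` on `S ⊆ ℕ` satisfies the extension property (with
respect to vertices in `S`). -/
def ExtensionPropertyOn (R : SimpleGraph ℕ) (S : Set ℕ) : Prop :=
  ∀ A B : Finset ℕ, ↑A ⊆ S → ↑B ⊆ S → Disjoint A B →
    ∃ v ∈ S, v ∉ A ∧ v ∉ B ∧ (∀ a ∈ A, R.Adj v a) ∧ ∀ b ∈ B, ¬ R.Adj v b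

/-- `F` is the vertex set of an induced copy of the finite graph `G` in `R`: there is
an injection `f` of the vertices of `G` onto `F` with `u, v` adjacent in `G` iff
`f u, f v` are adjacent in `R`. -/
def IsInducedCopy {V : Type} [Fintype V] (G : SimpleGraph V) (R : SimpleGraph ℕ)
    (F : Finset ℕ) : Prop :=
  ∃ f : V → ℕ, Function.Injective f ∧ (∀ u v : V, G.Adj u v ↔ R.Adj (f u) (f v)) ∧
    Finset.image f Finset.univ = F

attribute [local instance] Ultrafilter.semigroup

/-- A compact Hausdorff right topological semigroup has a minimal left ideal, and it is closed. -/
theorem exists_minimal_left_ideal {M : Type*} [Semigroup M] [Nonempty M] [TopologicalSpace M]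
    [CompactSpace M] [T2Space M] (hM : ∀ r : M, Continuous (· * r)) :
    ∃ L : Set M, L.Nonempty ∧ IsClosed L ∧ (∀ s, ∀ x ∈ L, s * x ∈ L) ∧
      ∀ x ∈ L, ∀ y ∈ L, ∃ s, s * x = y := by
  let S : Set (Set M) := {N | IsClosed N ∧ N.Nonempty ∧ ∀ s, ∀ x ∈ N, s * x ∈ N}
  obtain ⟨L, hL⟩ : ∃ N, Minimal (· ∈ S) N := by
    refine zorn_superset _ fun c hcs hc => ?_
    refine ⟨⋂₀ c, ⟨isClosed_sInter fun t ht => (hcs ht).1, ?_, fun s x hx => ?_⟩, fun s hs =>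
      Set.sInter_subset_of_mem hs⟩
    · obtain rfl | hne := c.eq_empty_or_nonempty
      · rw [Set.sInter_empty]
        exact Set.univ_nonempty
      · rw [Set.sInter_eq_iInter]
        have := hne.coe_sort
        refine IsCompact.nonempty_iInter_of_directed_nonempty_isCompact_isClosed _
          (DirectedOn.directed_val (IsChain.directedOn hc.symm)) (fun i => (hcs i.prop).2.1)
          (fun i => (hcs i.prop).1.isCompact) fun i => (hcs i.prop).1
    · exact fun t ht => (hcs ht).2.2 s x (hx t ht)
  obtain ⟨hcl, hne, hideal⟩ := hL.prop
  refine ⟨L, hne, hcl, hideal, fun x hx y hy => ?_⟩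
  have : Set.range (· * x) = L := by
    apply hL.eq_of_subset
    · refine ⟨(isCompact_range (hM x)).isClosed, Set.range_nonempty _, ?_⟩
      rintro s _ ⟨t, rfl⟩
      exact ⟨s * t, mul_assoc _ _ _⟩
    · rintro _ ⟨s, rfl⟩
      exact hideal s x hx
  rw [← this] at hy
  exact hy

theorem Ultrafilter.map_mulHom {M N F : Type*} [Semigroup M] [Semigroup N] [FunLike F M N]
    [MulHomClass F M N] (f : F) (U V : Ultrafilter M) :
    (U * V).map f = U.map f * V.map f := by
  ext s
  change (∀ᶠ x in ↑(U * V), f x ∈ s) ↔ ∀ᶠ x in ↑(U.map f * V.map f), x ∈ s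
  simp only [Ultrafilter.eventually_mul, map_mul, Ultrafilter.coe_map, Filter.eventually_map]

/-- Substitution of the letter `a` for the variable `none`. -/
def FreeMonoid.fill {α : Type*} (a : α) : FreeMonoid (Option α) →* FreeMonoid α :=
  FreeMonoid.map fun o => o.getD a

/-- The alphabet `α` carries a system of ultrafilters on words which are left-absorbing under
substitution of letters for the variable `none` in left variable words. -/
theorem exists_absorbing_ultrafilters (α : Type*) :
    ∃ (p : Ultrafilter (FreeMonoid α)) (q : Ultrafilter (FreeMonoid (Option α))),
      (∀ᶠ v : FreeMonoid (Option α) in q, ∃ w, v = FreeMonoid.of none * w) ∧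
      (∀ a, p * q.map (FreeMonoid.fill a) = p) ∧
      ∀ a b, q.map (FreeMonoid.fill a) * q.map (FreeMonoid.fill b) =
        q.map (FreeMonoid.fill a) := by
  obtain ⟨L, hne, hcl, hideal, hmin⟩ :=
    exists_minimal_left_ideal (M := Ultrafilter (FreeMonoid α)) Ultrafilter.continuous_mul_left
  obtain ⟨p, hpL, -⟩ := exists_idempotent_in_compact_subsemigroup
    Ultrafilter.continuous_mul_left L hne hcl.isCompact fun x _ y hy => hideal x y hy
  have habs : ∀ f ∈ L, f * f = f → ∀ g ∈ L, g * f = g := by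
    intro f hf hff g hg
    obtain ⟨s, rfl⟩ := hmin f hf g hg
    rw [mul_assoc, hff]
  let ι : FreeMonoid α →* FreeMonoid (Option α) := FreeMonoid.map some
  let X : Set (FreeMonoid (Option α)) := {v | ∃ w, v = FreeMonoid.of none * w}
  let J : Set (Ultrafilter (FreeMonoid (Option α))) := {u | X ∈ u}
  have hJ : ∀ u ∈ J, ∀ v, u * v ∈ J := by
    intro u hu v
    change ∀ᶠ x in ↑(u * v), x ∈ X
    rw [Ultrafilter.eventually_mul]
    filter_upwards [hu]
    rintro _ ⟨w, rfl⟩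
    exact Filter.Eventually.of_forall fun x => ⟨w * x, mul_assoc _ _ _⟩
  obtain ⟨_, ⟨u, hu, rfl⟩, hidem⟩ := exists_idempotent_in_compact_subsemigroup
    Ultrafilter.continuous_mul_left ((· * p.map ι) '' J)
    (Set.Nonempty.image _ ⟨pure (FreeMonoid.of none), Filter.mem_pure.2 ⟨1, (mul_one _).symm⟩⟩)
    ((ultrafilter_isClosed_basic X).isCompact.image (Ultrafilter.continuous_mul_left _))
    (by
      rintro _ ⟨u, hu, rfl⟩ _ ⟨v, hv, rfl⟩
      exact ⟨u * p.map ι * v, hJ _ (hJ _ hu _) _, mul_assoc _ _ _⟩)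
  have hmem : ∀ a : α, (u * p.map ι).map (FreeMonoid.fill a) ∈ L := by
    intro a
    have : (p.map ι).map (FreeMonoid.fill a) = p := by
      rw [Ultrafilter.map_map]
      convert! Ultrafilter.map_id p
      ext w
      change FreeMonoid.map _ (FreeMonoid.map some w) = w
      rw [FreeMonoid.map_map]
      exact DFunLike.congr_fun FreeMonoid.map_id w
    rw [Ultrafilter.map_mulHom, this]
    exact hideal _ _ hpL
  have hid : ∀ a : α, (u * p.map ι).map (FreeMonoid.fill a) *
      (u * p.map ι).map (FreeMonoid.fill a) =
        (u * p.map ι).map (FreeMonoid.fill a) := by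
    intro a
    rw [← Ultrafilter.map_mulHom, hidem]
  exact ⟨p, u * p.map ι, hJ _ hu _, fun a => habs _ (hmem a) (hid a) _ hpL,
    fun a b => habs _ (hmem b) (hid b) _ (hmem a)⟩

/-- The pigeonhole principle behind the Carlson–Simpson theorem: a finite colouring of words has a
monochromatic set `B` any finite part of which can be prolonged inside `B` by a common left
variable word. -/
theorem exists_monochromatic_prolongable {α κ : Type*} [Finite α] [Finite κ]
    (χ : FreeMonoid α → κ) :
    ∃ B : Set (FreeMonoid α), B.Nonempty ∧ (∃ k, ∀ w ∈ B, χ w = k) ∧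
      ∀ F : Set (FreeMonoid α), F.Finite → F ⊆ B → ∃ v : FreeMonoid (Option α),
        ∀ w ∈ F, ∀ a, w * (FreeMonoid.of a * FreeMonoid.fill a v) ∈ B := by
  obtain ⟨p, q, hq, hpq, hqq⟩ := exists_absorbing_ultrafilters α
  obtain ⟨k, hk⟩ : ∃ k, ∀ᶠ w in p, χ w = k := by
    have : ∀ᶠ w in p, ∃ k, χ w = k := Filter.Eventually.of_forall fun w => ⟨_, rfl⟩
    rwa [Ultrafilter.eventually_exists_iff] at this
  let B : Set (FreeMonoid α) :=
    {w | χ w = k ∧ ∀ a, ∀ᶠ v in q, χ (w * FreeMonoid.fill a v) = k}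
  have hB : ∀ᶠ w in p, w ∈ B := by
    refine hk.and (Filter.eventually_all.2 fun a => ?_)
    rw [← hpq a, Ultrafilter.eventually_mul] at hk
    exact hk
  have hstep : ∀ w ∈ B, ∀ a, ∀ᶠ v in q, w * FreeMonoid.fill a v ∈ B := by
    intro w hw a
    refine (hw.2 a).and (Filter.eventually_all.2 fun b => ?_)
    have h : ∀ᶠ s in q.map (FreeMonoid.fill a), χ (w * s) = k := hw.2 a
    rw [← hqq a b, Ultrafilter.eventually_mul] at h
    filter_upwards [h] with v hv
    filter_upwards [hv] with v' hv'
    rwa [mul_assoc]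
  refine ⟨B, hB.exists, ⟨k, fun w hw => hw.1⟩, fun F hF hFB => ?_⟩
  have hall : ∀ᶠ v in q, ∀ w ∈ F, ∀ a, w * FreeMonoid.fill a v ∈ B :=
    (Filter.eventually_all_finite hF).2 fun w hw =>
      Filter.eventually_all.2 fun a => hstep w (hFB hw) a
  obtain ⟨_, hv, w, rfl⟩ := (hall.and hq).exists
  exact ⟨w, by simpa [FreeMonoid.fill] using hv⟩

/-- A surjection `ℕ → ℕ` whose values make their first appearances in increasing order; these are
the infinite parameter words, `first n` being the position of the first occurrence of the `n`th
parameter. -/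
structure RigidSurj where
  toFun : ℕ → ℕ
  first : ℕ → ℕ
  toFun_first : ∀ n, toFun (first n) = n
  lt_of_lt_first : ∀ {n i}, i < first n → toFun i < n

namespace RigidSurj

instance : CoeFun RigidSurj fun _ => ℕ → ℕ := ⟨toFun⟩

theorem first_strictMono (W : RigidSurj) : StrictMono W.first := by
  refine strictMono_nat_of_lt_succ fun n => ?_
  by_contra! h
  rcases h.lt_or_eq with h | h
  · have := W.lt_of_lt_first h
    rw [W.toFun_first] at this
    omega
  · have := congrArg W h
    rw [W.toFun_first, W.toFun_first] at this
    omega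

theorem first_toFun_le (W : RigidSurj) (i : ℕ) : W.first (W i) ≤ i := by
  by_contra! h
  exact (W.lt_of_lt_first h).false

theorem le_first (W : RigidSurj) (n : ℕ) : n ≤ W.first n :=
  W.first_strictMono.le_apply

theorem toFun_le (W : RigidSurj) (i : ℕ) : W i ≤ i :=
  (W.le_first _).trans (W.first_toFun_le i)

theorem first_eq_of_toFun_eq (W : RigidSurj) {n : ℕ} (h : W n = n) : W.first n = n := by
  refine le_antisymm ?_ (W.le_first n)
  have := W.first_toFun_le n
  rwa [h] at this

/-- The identity parameter word. -/
protected def id : RigidSurj where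
  toFun i := i
  first n := n
  toFun_first _ := rfl
  lt_of_lt_first h := h

/-- Composition of parameter words. -/
def comp (V W : RigidSurj) : RigidSurj where
  toFun i := V (W i)
  first n := W.first (V.first n)
  toFun_first n := by rw [W.toFun_first, V.toFun_first]
  lt_of_lt_first h := V.lt_of_lt_first (W.lt_of_lt_first h)

/-- The fusion of a sequence of parameter words, each refining the previous one beyond a growing
initial segment. -/
theorem exists_fusion (Φ : ℕ → RigidSurj → Prop) (h0 : Φ 0 RigidSurj.id)
    (hstep : ∀ n P, Φ n P → ∃ W : RigidSurj, (∀ i ≤ n, W i = i) ∧ Φ (n + 1) (W.comp P)) :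
    ∃ W : RigidSurj, ∀ n, ∃ P, Φ n P ∧ (∀ N ≤ n, W.first N = P.first N) ∧
      ∀ i < P.first n, W i = P i := by
  choose! w hw hΦ using hstep
  let P : ℕ → RigidSurj := fun n => Nat.rec RigidSurj.id (fun n Q => (w n Q).comp Q) n
  have hP : ∀ n, Φ n (P n) := fun n => by
    induction n with
    | zero => exact h0
    | succ n ih => exact hΦ n _ ih
  have hfix : ∀ n, ∀ i ≤ n, w n (P n) i = i := fun n => hw n _ (hP n)
  have htoFun : ∀ n i, P n i ≤ n → ∀ m ≥ n, P m i = P n i := by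
    intro n i hi m hm
    induction m, hm using Nat.le_induction with
    | base => rfl
    | succ m hm ih =>
      change w m (P m) (P m i) = _
      rw [ih, hfix m _ (hi.trans hm)]
  have hfirst : ∀ n, ∀ N ≤ n, ∀ m ≥ n, (P m).first N = (P n).first N := by
    intro n N hN m hm
    induction m, hm using Nat.le_induction with
    | base => rfl
    | succ m hm ih =>
      change (P m).first ((w m (P m)).first N) = _
      rw [first_eq_of_toFun_eq _ (hfix m _ (hN.trans hm)), ih]
  have htoFun' : ∀ i, ∀ m ≥ i, P m i = P i i := fun i => htoFun i i (toFun_le _ _)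
  have hfirst' : ∀ N, ∀ m ≥ N, (P m).first N = (P N).first N := fun N => hfirst N N le_rfl
  refine ⟨⟨fun i => P i i, fun N => (P N).first N, fun N => ?_, fun {N i} hi => ?_⟩,
    fun n => ⟨P n, hP n, fun N hN => (hfirst' N n hN).symm, fun i hi => ?_⟩⟩
  · have := toFun_first (P ((P N).first N)) N
    rwa [hfirst' N _ (le_first (P N) N)] at this
  · rw [← hfirst' N _ (le_max_left N i)] at hi
    have := lt_of_lt_first _ hi
    rwa [htoFun' _ _ (le_max_right N i)] at this
  · change P i i = _
    rw [← htoFun' i _ (le_max_left i n)]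
    exact htoFun n i (lt_of_lt_first _ hi).le _ (le_max_right i n)

/-- The limit of an increasing chain of finite parameter words. -/
theorem exists_of_lists (Φ : ℕ → List ℕ → Prop) (h0 : Φ 0 [])
    (hlt : ∀ n l, Φ n l → ∀ i ∈ l, i < n)
    (hstep : ∀ n l, Φ n l → ∃ l', Φ (n + 1) (l ++ n :: l')) :
    ∃ W : RigidSurj, ∀ n, Φ n ((List.range (W.first n)).map W) := by
  choose! g hg using hstep
  let L : ℕ → List ℕ := fun n => Nat.rec [] (fun n l => l ++ n :: g n l) n
  have hsucc : ∀ n, L (n + 1) = L n ++ n :: g n (L n) := fun n => rfl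
  have hL : ∀ n, Φ n (L n) := fun n => by
    induction n with
    | zero => exact h0
    | succ n ih => exact hg n _ ih
  have hpre : ∀ n, ∀ m ≥ n, L n <+: L m := by
    intro n m hm
    induction m, hm using Nat.le_induction with
    | base => exact List.prefix_rfl
    | succ m hm ih => exact ih.trans ⟨_, (hsucc m).symm⟩
  have hlen : ∀ n, n ≤ (L n).length := fun n => by
    induction n with
    | zero => exact Nat.zero_le _
    | succ n ih =>
      rw [hsucc, List.length_append, List.length_cons]
      omega
  have hget : ∀ n m i, i < (L n).length → i < (L m).length →
      (L n).getD i 0 = (L m).getD i 0 := by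
    have key : ∀ n m i, n ≤ m → i < (L n).length → (L n).getD i 0 = (L m).getD i 0 := by
      intro n m i hnm hi
      obtain ⟨t, ht⟩ := hpre n m hnm
      rw [← ht, List.getD_append _ _ _ _ hi]
    intro n m i hn hm
    rcases le_total n m with h | h
    · exact key n m i h hn
    · exact (key m n i h hm).symm
  have hval : ∀ n i, i < (L n).length → (L (i + 1)).getD i 0 = (L n).getD i 0 :=
    fun n i hi => hget (i + 1) n i (hlen (i + 1)) hi
  refine ⟨⟨fun i => (L (i + 1)).getD i 0, fun n => (L n).length, fun n => ?_, fun {n i} hi => ?_⟩,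
    fun n => ?_⟩
  · have : (L n).length < (L (n + 1)).length := by simp [hsucc]
    rw [hval (n + 1) _ this, hsucc, List.getD_append_right _ _ _ _ le_rfl]
    simp
  · rw [hval n i hi, List.getD_eq_getElem _ _ hi]
    exact hlt n _ (hL n) _ (List.getElem_mem hi)
  · convert! hL n
    refine List.ext_getElem (by simp) fun i h₁ h₂ => ?_
    rw [List.getElem_map, List.getElem_range]
    change (L (i + 1)).getD i 0 = _
    rw [hval n i h₂, List.getD_eq_getElem _ _ h₂]

end RigidSurj

/-- A colouring of finite words, a word being a length `N` together with a function whose values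
only matter below `N`. -/
def IsWordColoring {κ : Type*} (c : ℕ → (ℕ → ℕ) → κ) : Prop :=
  ∀ N u u', (∀ i < N, u i = u' i) → c N u = c N u'

/-- The colouring obtained by evaluating `c` on the words `u ∘ W`. -/
def RigidSurj.pull {κ : Type*} (W : RigidSurj) (c : ℕ → (ℕ → ℕ) → κ) (N : ℕ) (u : ℕ → ℕ) : κ :=
  c (W.first N) (u ∘ W)

theorem IsWordColoring.pull {κ : Type*} {c : ℕ → (ℕ → ℕ) → κ} (hc : IsWordColoring c)
    (W : RigidSurj) : IsWordColoring (W.pull c) :=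
  fun _ _ _ h => hc _ _ _ fun _ hi => h _ (W.lt_of_lt_first hi)

theorem IsWordColoring.eq_getD {κ : Type*} {c : ℕ → (ℕ → ℕ) → κ} (hc : IsWordColoring c) (N : ℕ)
    (u : ℕ → ℕ) {l : List ℕ} (h : (List.range N).map u = l) :
    c N u = c l.length (fun i => l.getD i 0) := by
  subst h
  rw [List.length_map, List.length_range]
  exact hc _ _ _ fun i hi => by simp [List.getD, hi]

/-- The Carlson–Simpson theorem for words over `{0, …, m - 1}`. -/
theorem IsWordColoring.exists_constant_words {κ : Type*} [Finite κ] {c : ℕ → (ℕ → ℕ) → κ}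
    (hc : IsWordColoring c) {m : ℕ} (hm : 0 < m) :
    ∃ W : RigidSurj, (∀ i < m, W i = i) ∧ ∃ k, ∀ N ≥ m, ∀ x : ℕ → ℕ, (∀ i < m, x i = i) →
      (∀ i < N, x i < m) → W.pull c N x = k := by
  let e : FreeMonoid (Fin m) → List ℕ := fun w => List.range m ++ w.toList.map Fin.val
  obtain ⟨B, ⟨w₀, hw₀⟩, ⟨k, hk⟩, hB⟩ := exists_monochromatic_prolongable fun w : FreeMonoid (Fin m) =>
    c (e w).length fun i => (e w).getD i 0
  let Φ : ℕ → List ℕ → Prop := fun n l => (∀ i ∈ l, i < n) ∧ (n < m → l = List.range n) ∧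
    (m ≤ n → ∀ x : ℕ → ℕ, (∀ i < m, x i = i) → (∀ i < n, x i < m) → ∃ w ∈ B, l.map x = e w)
  obtain ⟨W, hW⟩ : ∃ W : RigidSurj, ∀ n, Φ n ((List.range (W.first n)).map W) := by
    refine RigidSurj.exists_of_lists Φ ⟨by simp, by simp, by omega⟩ (fun n l h => h.1) ?_
    rintro n l ⟨hl, hlt, hge⟩
    rcases lt_trichotomy (n + 1) m with h | h | h
    · refine ⟨[], ?_, fun _ => ?_, by omega⟩
      · rw [hlt (by omega), ← List.range_succ]
        simp
      · rw [hlt (by omega), ← List.range_succ]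
    · have heq : l ++ n :: w₀.toList.map Fin.val = e w₀ := by
        rw [hlt (by omega)]
        simp only [e, ← h, List.range_succ, List.append_assoc, List.singleton_append]
      refine ⟨w₀.toList.map Fin.val, ?_, by omega, fun _ x hx _ => ⟨w₀, hw₀, ?_⟩⟩
      · rw [heq, h]
        simp [e, or_imp]
      · rw [heq]
        refine (List.map_congr_left (g := id) fun i hi => hx i ?_).trans (List.map_id _)
        revert i
        simp [e, or_imp]
    · have hfin : {w | w ∈ B ∧ (e w).length = l.length}.Finite := by
        refine Set.Finite.subset (s := {w : FreeMonoid (Fin m) | w.toList.length = l.length - m})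
          (List.finite_length_eq _ _) ?_
        rintro w ⟨-, hw⟩
        simp only [e, List.length_append, List.length_range, List.length_map] at hw
        rw [Set.mem_ofPred_eq]
        omega
      obtain ⟨v, hv⟩ := hB _ hfin fun w hw => hw.1
      refine ⟨v.toList.map fun o => o.elim n Fin.val, ?_, by omega, fun _ x hx hxm => ?_⟩
      · simp only [List.mem_append, List.mem_cons, List.mem_map]
        rintro i (hi | rfl | ⟨_ | a, -, rfl⟩)
        · exact (hl i hi).trans n.lt_succ_self
        · exact i.lt_succ_self
        · exact n.lt_succ_self
        · exact a.2.trans (by omega)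
      · obtain ⟨w, hwB, hw⟩ := hge (by omega) x hx fun i hi => hxm i (by omega)
        refine ⟨_, hv w ⟨hwB, by rw [← hw, List.length_map]⟩ ⟨x n, hxm n (by omega)⟩, ?_⟩
        rw [List.map_append, hw]
        simp only [e, FreeMonoid.fill, FreeMonoid.toList_mul, FreeMonoid.toList_of,
          FreeMonoid.toList_map, List.map_append, List.append_assoc, List.map_cons, List.map_map,
          List.singleton_append]
        congr 3
        refine List.map_congr_left ?_
        rintro (_ | a) -
        · rfl
        · exact hx _ a.2
  refine ⟨W, fun i hi => ?_, k, fun N hN x hx hxm => ?_⟩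
  · have := congrArg List.length ((hW i).2.1 hi)
    rw [List.length_map, List.length_range, List.length_range] at this
    conv_lhs => rw [← this]
    exact W.toFun_first i
  · obtain ⟨w, hwB, hw⟩ := (hW N).2.2 hN x hx hxm
    rw [List.map_map] at hw
    exact (hc.eq_getD _ _ hw).trans (hk w hwB)

/-- On `[0, N)`, the word `u` is a surjection onto `[0, k)` whose values make their first appearances
in increasing order, at the positions given by `ν`. -/
structure IsRigidWord (k N : ℕ) (u ν : ℕ → ℕ) : Prop where
  first_lt : ∀ {j}, j < k → ν j < N
  apply_first : ∀ {j}, j < k → u (ν j) = j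
  lt_of_lt_first : ∀ {j i}, j < k → i < ν j → u i < j
  apply_lt : ∀ {i}, i < N → u i < k

theorem IsRigidWord.comp {k N : ℕ} {u ν : ℕ → ℕ} (h : IsRigidWord k N u ν) (W : RigidSurj) :
    IsRigidWord k (W.first N) (u ∘ W) (W.first ∘ ν) where
  first_lt hj := W.first_strictMono (h.first_lt hj)
  apply_first hj := by
    simp only [Function.comp_apply, W.toFun_first]
    exact h.apply_first hj
  lt_of_lt_first hj hi := h.lt_of_lt_first hj (W.lt_of_lt_first hi)
  apply_lt hi := h.apply_lt (W.lt_of_lt_first hi)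

theorem IsRigidWord.restrict {k N : ℕ} {u ν : ℕ → ℕ} (h : IsRigidWord (k + 1) N u ν) :
    IsRigidWord k (ν k) u ν where
  first_lt {j} hj := by
    by_contra! hle
    rcases hle.lt_or_eq with hlt | heq
    · have := h.lt_of_lt_first (hj.trans k.lt_succ_self) hlt
      rw [h.apply_first k.lt_succ_self] at this
      omega
    · have := congrArg u heq
      rw [h.apply_first k.lt_succ_self, h.apply_first (hj.trans k.lt_succ_self)] at this
      omega
  apply_first hj := h.apply_first (hj.trans k.lt_succ_self)
  lt_of_lt_first hj hi := h.lt_of_lt_first (hj.trans k.lt_succ_self) hi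
  apply_lt hi := h.lt_of_lt_first k.lt_succ_self hi

namespace IsWordColoring

variable {κ : Type*} [Finite κ] {c : ℕ → (ℕ → ℕ) → κ}

theorem exists_stable_at (hc : IsWordColoring c) (k n : ℕ) :
    ∃ W : RigidSurj, (∀ i ≤ n, W i = i) ∧ ∀ N u ν, IsRigidWord (k + 1) N u ν → ν k = n →
      W.pull c N u = W.pull c (n + 1) u := by
  let ext : (Fin n → Fin (k + 1)) → ℕ → ℕ := fun V i => if h : i < n then V ⟨i, h⟩ else k
  obtain ⟨W, hW, K, hK⟩ := exists_constant_words
    (c := fun N x (V : Fin n → Fin (k + 1)) => c N (ext V ∘ x))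
    (fun N u u' h => funext fun V => hc _ _ _ fun i hi => congrArg (ext V) (h i hi))
    n.succ_pos
  refine ⟨W, fun i hi => hW i (by omega), ?_⟩
  rintro N u ν h rfl
  let V : Fin (ν k) → Fin (k + 1) := fun i =>
    ⟨u i, h.apply_lt (i.2.trans (h.first_lt k.lt_succ_self))⟩
  let x : ℕ → ℕ := fun i => if i ≤ ν k then i else ν (u i)
  have hνle : ∀ j ≤ k, ν j ≤ ν k := fun j hj => by
    rcases hj.lt_or_eq with hj | rfl
    · exact (h.restrict.first_lt hj).le
    · exact le_rfl
  have hextV : ∀ i ≤ ν k, ext V i = u i := by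
    intro i hi
    rcases hi.lt_or_eq with hi | rfl
    · simp [ext, V, hi]
    · simp [ext, h.apply_first k.lt_succ_self]
  have hext : ∀ i < N, ext V (x i) = u i := by
    intro i hi
    by_cases hle : i ≤ ν k
    · simp only [x, hle, if_true, hextV]
    · have hu := h.apply_lt hi
      simp only [x, hle, if_false]
      rw [hextV _ (hνle _ (by omega)), h.apply_first hu]
  have hxlt : ∀ i < N, x i < ν k + 1 := by
    intro i hi
    by_cases hle : i ≤ ν k
    · simp only [x, hle, if_true]
      omega
    · simp only [x, hle, if_false]
      have := hνle (u i) (by have := h.apply_lt hi; omega)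
      omega
  have hxid : ∀ i < ν k + 1, x i = i := fun i hi => by simp [x, Nat.lt_succ_iff.1 hi]
  have hN : ν k + 1 ≤ N := h.first_lt k.lt_succ_self
  have key : ∀ M ≤ N, ν k + 1 ≤ M → W.pull c M u = K V := by
    intro M hM hM'
    rw [← hK M hM' x hxid fun i hi => hxlt i (by omega)]
    exact hc _ _ _ fun i hi => (hext _ ((W.lt_of_lt_first hi).trans_le hM)).symm
  rw [key N le_rfl hN, key (ν k + 1) hN le_rfl]

theorem exists_stable (hc : IsWordColoring c) (k : ℕ) :
    ∃ W : RigidSurj, ∀ N u ν, IsRigidWord (k + 1) N u ν →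
      W.pull c N u = W.pull c (ν k + 1) u := by
  obtain ⟨W, hW⟩ := RigidSurj.exists_fusion
    (fun n P => ∀ N u ν, IsRigidWord (k + 1) N u ν → ν k < n →
      P.pull c N u = P.pull c (ν k + 1) u) (fun _ _ _ _ h => absurd h (Nat.not_lt_zero _)) <| by
    intro n P hP
    obtain ⟨W, hfix, hW⟩ := (hc.pull P).exists_stable_at k n
    refine ⟨W, hfix, fun N u ν h hn => ?_⟩
    rcases (Nat.lt_succ_iff.1 hn).lt_or_eq with hn | hn
    · have h1 : W.first (ν k) = ν k := W.first_eq_of_toFun_eq (hfix _ hn.le)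
      have h2 : W.first (ν k + 1) = ν k + 1 := W.first_eq_of_toFun_eq (hfix _ hn)
      have := hP _ _ _ (h.comp W) (by rwa [Function.comp_apply, h1])
      rw [Function.comp_apply, h1] at this
      change P.pull c (W.first N) (u ∘ W) = P.pull c (W.first (ν k + 1)) (u ∘ W)
      rw [this, h2]
    · subst hn
      exact hW N u ν h rfl
  refine ⟨W, fun N u ν h => ?_⟩
  obtain ⟨P, hP, hfirst, htoFun⟩ := hW N
  have hk := h.first_lt k.lt_succ_self
  have key : ∀ M ≤ N, W.pull c M u = P.pull c M u := by
    intro M hM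
    rw [RigidSurj.pull, hfirst M hM]
    exact hc _ _ _ fun i hi => congrArg u
      (htoFun i (hi.trans_le (P.first_strictMono.monotone hM)))
  rw [key N le_rfl, key _ hk]
  exact hP N u ν h hk

/-- The Carlson–Simpson theorem for finite parameter words with `k` parameters. -/
theorem exists_constant (hc : IsWordColoring c) (k : ℕ) :
    ∃ W : RigidSurj, ∀ N u ν N' u' ν', IsRigidWord k N u ν → IsRigidWord k N' u' ν' →
      W.pull c N u = W.pull c N' u' := by
  induction k generalizing c with
  | zero =>
    refine ⟨RigidSurj.id, fun N u ν N' u' ν' h h' => ?_⟩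
    obtain rfl : N = 0 := by
      by_contra hN
      exact Nat.not_lt_zero _ (h.apply_lt (Nat.pos_of_ne_zero hN))
    obtain rfl : N' = 0 := by
      by_contra hN
      exact Nat.not_lt_zero _ (h'.apply_lt (Nat.pos_of_ne_zero hN))
    exact hc _ _ _ fun i hi => absurd hi (Nat.not_lt_zero _)
  | succ k ih =>
    obtain ⟨W, hW⟩ := hc.exists_stable k
    let c' : ℕ → (ℕ → ℕ) → κ := fun n V => W.pull c (n + 1) fun i => if i < n then V i else k
    have hc' : IsWordColoring c' := by
      intro N u u' h
      refine hc.pull W _ _ _ fun i _ => ?_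
      split_ifs with hi
      · exact h i hi
      · rfl
    obtain ⟨W', hW'⟩ := ih hc'
    have key : ∀ N u ν, IsRigidWord (k + 1) N u ν →
        (W'.comp W).pull c N u = W'.pull c' (ν k) u := by
      intro N u ν h
      refine (hW _ _ _ (h.comp W')).trans (hc.pull W _ _ _ fun i hi => ?_)
      split_ifs with hi'
      · rfl
      · obtain rfl : i = W'.first (ν k) := by
          simp only [Function.comp_apply] at hi
          omega
        rw [Function.comp_apply, W'.toFun_first, h.apply_first k.lt_succ_self]
    refine ⟨W'.comp W, fun N u ν N' u' ν' h h' => ?_⟩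
    rw [key N u ν h, key N' u' ν' h']
    exact hW' _ _ _ _ _ _ h.restrict h'.restrict

end IsWordColoring

theorem RigidSurj.isRigidWord (W : RigidSurj) (k : ℕ) :
    IsRigidWord k (W.first k) W W.first where
  first_lt hj := W.first_strictMono hj
  apply_first _ := W.toFun_first _
  lt_of_lt_first _ hi := W.lt_of_lt_first hi
  apply_lt hi := W.lt_of_lt_first hi

/-- Any partition of `ℕ` into infinitely many classes is induced by a rigid surjection. -/
theorem RigidSurj.exists_of_partition {β : Type*} (f : ℕ → β)
    (hf : {j | ∀ i < j, f i ≠ f j}.Infinite) :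
    ∃ U : RigidSurj, ∀ i j, U i = U j ↔ f i = f j := by
  classical
  let A : ℕ → Prop := fun j => ∀ i < j, f i ≠ f j
  have hex : ∀ j, ∃ i, f i = f j := fun j => ⟨j, rfl⟩
  let s : ℕ → ℕ := fun j => Nat.find (hex j)
  have hs : ∀ j, f (s j) = f j := fun j => Nat.find_spec (hex j)
  have hsA : ∀ j, A (s j) := fun j i hi h => Nat.find_min (hex j) hi (h.trans (hs j))
  have hsle : ∀ j, s j ≤ j := fun j => Nat.find_min' (hex j) rfl
  have hAs : ∀ j, A j → s j = j := fun j hj =>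
    le_antisymm (hsle j) (not_lt.1 fun h => hj _ h (hs j))
  refine ⟨⟨fun j => Nat.count A (s j), Nat.nth A, fun n => ?_, fun {n i} hi => ?_⟩,
    fun i j => ⟨fun h => ?_, fun h => ?_⟩⟩
  · rw [hAs _ (Nat.nth_mem_of_infinite hf n), Nat.count_nth_of_infinite hf]
  · by_contra! hle
    have : Nat.nth A n ≤ Nat.nth A (Nat.count A (s i)) := Nat.nth_monotone hf hle
    rw [Nat.nth_count (hsA i)] at this
    exact absurd (this.trans (hsle i)) (not_le.2 hi)
  · have := congrArg (Nat.nth A) h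
    simp only at this
    rw [Nat.nth_count (hsA i), Nat.nth_count (hsA j)] at this
    rw [← hs i, this, hs]
  · have : s i = s j := by simp only [s, h]
    simp only [this]

/-- Finitely many binary words lie in a common parameter word whose number of parameters is bounded
in terms of their number. -/
theorem exists_envelope {V : Type*} [Fintype V] (m : V → ℕ) (p : V → ℕ → Bool) :
    ∃ (U : RigidSurj) (M : V → Fin (Nat.card (V → Bool × Bool) + 1)) (t : V → ℕ → Bool),
      ∀ v, U.first (M v) = m v ∧ ∀ j < m v, p v j = t v (U j) := by
  classical
  obtain ⟨L, hL⟩ : ∃ L, ∀ v, m v < L :=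
    ⟨Finset.univ.sup m + 1, fun v => Nat.lt_succ_iff.2 (Finset.le_sup (Finset.mem_univ v))⟩
  let col : ℕ → V → Bool × Bool := fun j v => (decide (m v ≤ j), p v j)
  let f : ℕ → (V → Bool × Bool) ⊕ ℕ := fun j => if j < L then Sum.inl (col j) else Sum.inr j
  have hfL : ∀ i j, i < L → f i = f j → j < L ∧ col i = col j := by
    intro i j hi hij
    by_cases hj : j < L
    · simp only [f, hi, hj, if_true, Sum.inl.injEq] at hij
      exact ⟨hj, hij⟩
    · simp [f, hi, hj] at hij
  have hcol : ∀ i j v, col i = col j → (m v ≤ i ↔ m v ≤ j) ∧ p v i = p v j := by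
    intro i j v hij
    have := congrFun hij v
    simp only [col, Prod.mk.injEq, decide_eq_decide] at this
    exact this
  have hinf : {j | ∀ i < j, f i ≠ f j}.Infinite := by
    refine (Set.Ici_infinite L).mono fun j hj i hi hij => ?_
    rcases lt_or_ge i L with h | h
    · exact absurd (hfL i j h hij).1 (not_lt.2 hj)
    · simp only [f, not_lt.2 h, not_lt.2 (Set.mem_Ici.1 hj), if_false, Sum.inr.injEq] at hij
      omega
  obtain ⟨U, hU⟩ := RigidSurj.exists_of_partition f hinf
  have hUf : ∀ j, f (U.first (U j)) = f j := fun j => (hU _ _).1 (U.toFun_first _)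
  have hfirst : ∀ v, U.first (U (m v)) = m v := fun v => by
    refine (U.first_toFun_le _).eq_of_not_lt fun hlt => ?_
    have := (hcol _ _ v (hfL _ _ (hlt.trans (hL v)) (hUf _)).2).1
    omega
  have hcard : ∀ v, U (m v) ≤ Nat.card (V → Bool × Bool) := by
    intro v
    have hlt : ∀ i < U (m v), U.first i < L := fun i hi => by
      have := U.first_strictMono hi
      rw [hfirst] at this
      exact this.trans (hL v)
    have := Nat.card_le_card_of_injective (fun i : Fin (U (m v)) => col (U.first i)) ?_
    · rwa [Nat.card_fin] at this
    · intro i j hij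
      have hf : f (U.first i) = f (U.first j) := by
        simp only [f, hlt i i.2, hlt j j.2, if_true]
        exact congrArg Sum.inl hij
      rw [← hU, U.toFun_first, U.toFun_first] at hf
      exact Fin.ext hf
  refine ⟨U, fun v => ⟨U (m v), Nat.lt_succ_iff.2 (hcard v)⟩, fun v j => p v (U.first j),
    fun v => ⟨hfirst v, fun j hj => ?_⟩⟩
  exact (hcol _ _ v (hfL j _ (hj.trans (hL v)) (hUf j).symm).2).2

/-- Every graph on `ℕ` embeds in a graph with the extension property. -/
theorem ExtensionProperty.exists_embedding {R : SimpleGraph ℕ} (hR : ExtensionProperty R)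
    (H : SimpleGraph ℕ) : Nonempty (H ↪g R) := by
  classical
  choose! v hvA hvB hAdj hNAdj using hR
  let step : (n : ℕ) → ((i : ℕ) → i < n → ℕ) → ℕ := fun n ih =>
    v ((Finset.univ.filter fun i : Fin n => H.Adj n i).image fun i : Fin n => ih i i.2)
      ((Finset.univ.filter fun i : Fin n => ¬ H.Adj n i).image fun i : Fin n => ih i i.2)
  let f : ℕ → ℕ := Nat.lt_wfRel.wf.fix step
  have hf : ∀ n, f n = step n fun i _ => f i := fun n => Nat.lt_wfRel.wf.fix_eq step n
  have key : ∀ n, ∀ i < n, f i ≠ f n ∧ (R.Adj (f n) (f i) ↔ H.Adj n i) := by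
    intro n
    induction n using Nat.strong_induction_on with
    | _ n ih =>
    have hinj : ∀ i < n, ∀ j < n, f i = f j → i = j := by
      intro i hi j hj hij
      rcases lt_trichotomy i j with h | h | h
      · exact absurd hij (ih j hj i h).1
      · exact h
      · exact absurd hij.symm (ih i hi j h).1
    have hdisj : Disjoint ((Finset.univ.filter fun i : Fin n => H.Adj n i).image fun i : Fin n => f i)
        ((Finset.univ.filter fun i : Fin n => ¬ H.Adj n i).image fun i : Fin n => f i) := by
      simp only [Finset.disjoint_left, Finset.mem_image, Finset.mem_filter_univ]
      rintro _ ⟨i, hi, rfl⟩ ⟨j, hj, hij⟩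
      obtain rfl := Fin.ext (hinj j j.2 i i.2 hij)
      exact hj hi
    intro i hi
    rw [hf n]
    by_cases h : H.Adj n i
    · have hmem : f i ∈ (Finset.univ.filter fun i : Fin n => H.Adj n i).image fun i : Fin n => f i :=
        Finset.mem_image.2 ⟨⟨i, hi⟩, by simpa using h, rfl⟩
      exact ⟨fun he => hvA _ _ hdisj (he.subst (motive := (· ∈ _)) hmem), iff_of_true (hAdj _ _ hdisj _ hmem) h⟩
    · have hmem : f i ∈ (Finset.univ.filter fun i : Fin n => ¬ H.Adj n i).image fun i : Fin n => f i :=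
        Finset.mem_image.2 ⟨⟨i, hi⟩, by simpa using h, rfl⟩
      exact ⟨fun he => hvB _ _ hdisj (he.subst (motive := (· ∈ _)) hmem), iff_of_false (hNAdj _ _ hdisj _ hmem) h⟩
  refine ⟨⟨⟨f, fun i j hij => ?_⟩, fun {i j} => ?_⟩⟩
  · rcases lt_trichotomy i j with h | h | h
    · exact absurd hij (key j i h).1
    · exact h
    · exact absurd hij.symm (key i j h).1
  · change R.Adj (f i) (f j) ↔ H.Adj i j
    rcases lt_trichotomy i j with h | rfl | h
    · rw [R.adj_comm, H.adj_comm]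
      exact (key j i h).2
    · simp
    · exact (key i j h).2

theorem ExtensionProperty.range {R : SimpleGraph ℕ} (hR : ExtensionProperty R) (ψ : R ↪g R) :
    ExtensionPropertyOn R (Set.range ψ) := by
  classical
  intro A B hA hB hAB
  obtain ⟨v, hvA, hvB, hadj, hnadj⟩ := hR (A.preimage ψ ψ.injective.injOn)
    (B.preimage ψ ψ.injective.injOn) (by
      rw [Finset.disjoint_left] at hAB ⊢
      simpa using fun a ha => hAB ha)
  refine ⟨ψ v, ⟨v, rfl⟩, by simpa using hvA, by simpa using hvB, fun a ha => ?_, fun b hb => ?_⟩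
  · obtain ⟨a, rfl⟩ := hA ha
    exact ψ.map_adj_iff.2 (hadj a (by simpa using ha))
  · obtain ⟨b, rfl⟩ := hB hb
    exact ψ.map_adj_iff.not.2 (hnadj b (by simpa using hb))

/-- The binary words, with `l` and a longer word `l'` adjacent when `l'` passes through `1` at the
level of `l`. -/
def passingGraph : SimpleGraph (List Bool) where
  Adj l l' := l'[l.length]? = some true ∨ l[l'.length]? = some true
  symm := ⟨fun _ _ h => h.symm⟩
  loopless := ⟨fun l h => by simp at h⟩

/-- The binary word of length `n` obtained from `p`. -/
def initWord (p : ℕ → Bool) (n : ℕ) : List Bool := (List.range n).map p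

theorem RigidSurj.exists_coding (R : SimpleGraph ℕ) (W : RigidSurj) [DecidableRel R.Adj] :
    ∃ g : R ↪g passingGraph,
      ∀ m, g m = initWord (fun i => decide (R.Adj m (W i))) (W.first m) := by
  have hlen : ∀ p n, (initWord p n).length = n := by simp [initWord]
  let g : ℕ → List Bool := fun m => initWord (fun i => decide (R.Adj m (W i))) (W.first m)
  have hinj : Function.Injective g := fun m m' h => by
    have := congrArg List.length h
    simp only [g, hlen] at this
    exact W.first_strictMono.injective this
  have hadj : ∀ m m', m < m' → ((g m')[(g m).length]? = some true ↔ R.Adj m m') := by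
    intro m m' h
    have := W.first_strictMono h
    simp [g, initWord, this, W.toFun_first, R.adj_comm]
  have hnadj : ∀ m m', m ≤ m' → (g m)[(g m').length]? = none := by
    intro m m' h
    have := W.first_strictMono.monotone h
    simpa [g, hlen] using this
  refine ⟨⟨⟨g, hinj⟩, fun {m m'} => ?_⟩, fun m => rfl⟩
  change (g m')[(g m).length]? = some true ∨ (g m)[(g m').length]? = some true ↔ _
  rcases lt_trichotomy m m' with h | rfl | h
  · rw [hadj _ _ h, hnadj _ _ h.le]
    simp
  · rw [hnadj _ _ le_rfl]
    simp
  · rw [hadj _ _ h, hnadj _ _ h.le]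
    simp [R.adj_comm]

/-- The Rado graph has finite big Ramsey degrees: for every finite graph `G` there is
`T` such that for every finite coloring of the induced copies of `G` in a Rado graph
`R`, there is an induced Rado subgraph of `R` in which the copies of `G` take at most
`T` colors. -/
theorem rado_finite_big_ramsey_degrees {V : Type} [Fintype V] (G : SimpleGraph V) :
    ∃ T : ℕ,
      ∀ R : SimpleGraph ℕ, ExtensionProperty R →
        ∀ r : ℕ, 1 ≤ r →
          ∀ c : Finset ℕ → Fin r,
            ∃ S : Set ℕ, ExtensionPropertyOn R S ∧
              {k : Fin r | ∃ F : Finset ℕ,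
                IsInducedCopy G R F ∧ ↑F ⊆ S ∧ c F = k}.ncard ≤ T := by
  classical
  let K := Nat.card (V → Bool × Bool) + 1
  refine ⟨Nat.card (V → Fin K × (Fin K → Bool)), fun R hR r _ c => ?_⟩
  obtain ⟨e⟩ := nonempty_equiv_of_countable (α := ℕ) (β := List Bool)
  obtain ⟨φ⟩ := hR.exists_embedding (passingGraph.comap e)
  let φ' : passingGraph ↪g R :=
    (SimpleGraph.Iso.comap e passingGraph).symm.toEmbedding.trans φ
  let cut : ℕ → (ℕ → ℕ) → ℕ → ℕ := fun N u M => sInf {i | i < N → u i = M}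
  have hcut : ∀ k N u ν, IsRigidWord k N u ν → ∀ M < k, cut N u M = ν M := by
    intro k N u ν h M hM
    refine IsLeast.csInf_eq ⟨fun _ => h.apply_first hM, fun i hi => ?_⟩
    by_contra! hlt
    exact (h.lt_of_lt_first hM hlt).ne (hi (hlt.trans (h.first_lt hM)))
  let word : ℕ → (ℕ → ℕ) → Fin K × (Fin K → Bool) → List Bool := fun N u τ =>
    initWord (fun i => τ.2 (Fin.ofNat K (u i))) (cut N u τ.1)
  let C : ℕ → (ℕ → ℕ) → (V → Fin K × (Fin K → Bool)) → Fin r := fun N u τ =>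
    c (Finset.univ.image fun v => φ' (word N u (τ v)))
  have hC : IsWordColoring C := by
    intro N u u' h
    have hcutN : ∀ M, cut N u M = cut N u' M := fun M =>
      congrArg sInf (Set.ext fun i => forall_congr' fun hi => by rw [h i hi])
    refine funext fun τ => congrArg c (Finset.image_congr fun v _ => congrArg φ' ?_)
    simp only [word, initWord, ← hcutN]
    refine List.map_congr_left fun i hi => ?_
    have hle : cut N u (τ v).1 ≤ N := Nat.sInf_le fun h => absurd h (lt_irrefl N)
    rw [h i ((List.mem_range.1 hi).trans_le hle)]
  obtain ⟨W, hW⟩ := hC.exists_constant K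
  obtain ⟨g, hg⟩ := W.exists_coding R
  refine ⟨Set.range (g.trans φ'), hR.range _, ?_⟩
  let χ := W.pull C (RigidSurj.id.first K) RigidSurj.id
  rw [← Set.ncard_univ]
  refine (Set.ncard_le_ncard ?_).trans (Set.ncard_image_le (f := χ) (Set.toFinite _))
  rintro k ⟨F, ⟨f, -, -, rfl⟩, hF, rfl⟩
  have : ∀ v, ∃ m, φ' (g m) = f v := fun v => hF (by simp)
  choose m hm using this
  obtain ⟨U, M, t, hU⟩ := exists_envelope m fun v i => decide (R.Adj (m v) i)
  refine ⟨fun v => (M v, fun i => t v i), trivial, ?_⟩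
  have hχ := hW _ _ _ _ _ _ (RigidSurj.id.isRigidWord K) (U.isRigidWord K)
  change χ = _ at hχ
  rw [hχ]
  refine congrArg c (Finset.image_congr fun v _ => ?_)
  simp only
  rw [← hm, hg]
  have hfirst : cut (W.first (U.first K)) (U ∘ W) (M v) = W.first (m v) := by
    rw [hcut _ _ _ _ ((U.isRigidWord K).comp W) _ (M v).2, Function.comp_apply, (hU v).1]
  simp only [word, hfirst]
  refine congrArg φ' (List.map_congr_left fun i hi => ?_)
  have hlt : W i < m v := W.lt_of_lt_first (List.mem_range.1 hi)
  have hK : U (W i) < K := (U.lt_of_lt_first ((hU v).1.symm ▸ hlt)).trans (M v).2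
  rw [(hU v).2 _ hlt]
  simp [Fin.ofNat, Nat.mod_eq_of_lt hK]
end

section
/- The Rado graph has the rainbow Ramsey property for k-bounded colorings: let G be a finite simple graph and k ≥ 2. Let R be a simple graph on vertex set ℕ satisfying the extension property. For every coloring c of the set of induced copies of G in R into countably many colors (i.e., c takes values in ℕ) such that each color is taken by at most k induced copies of G, there exists a set S ⊆ ℕ such that the induced subgraph of R on S again satisfies the extension property (with respect to vertices in S), and c is injective on the induced copies of G whose vertex set is contained in S; that is, no two distinct induced copies of G inside S receive the same color. -/
namespace RadoRainbow

/-! ### Variable words and the Carlson–Simpson theorem -/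

section Words

variable {α : Type}

/-- Substitute the letter `a` for the variable `none` in a variable word. -/
def subst (a : α) (v : List (Option α)) : List α :=
  v.map fun o => o.getD a

lemma subst_append (a : α) (v w : List (Option α)) :
    subst a (v ++ w) = subst a v ++ subst a w :=
  List.map_append

/-- The part of a variable word preceding the first occurrence of the variable. -/
def initialPart (v : List (Option α)) : List α :=
  (v.takeWhile Option.isSome).reduceOption

/-- Finitely many sets of words are simultaneously unable to distinguish the substitution
instances of some variable word. -/
lemma exists_indistinguishing_word [Finite α] {τ : Type} [Finite τ] (s : τ → Set (List α)) :
    ∃ v : List (Option α), none ∈ v ∧ ∀ t a b, subst a v ∈ s t ↔ subst b v ∈ s t := by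
  obtain ⟨ι, _, h⟩ := Combinatorics.Line.exists_mono_in_high_dimension α (τ → Prop)
  obtain ⟨l, κ, hl⟩ := h fun x t => Finset.univ.toList.map x ∈ s t
  have key : ∀ a, subst a (Finset.univ.toList.map l.idxFun) = Finset.univ.toList.map (l a) := by
    intro a
    simp only [subst, List.map_map]
    rfl
  refine ⟨Finset.univ.toList.map l.idxFun, ?_, fun t a b => ?_⟩
  · obtain ⟨i, hi⟩ := l.proper
    exact List.mem_map.2 ⟨i, by simp, hi⟩
  · rw [key, key]
    exact iff_of_eq (congr_fun ((hl a).trans (hl b).symm) t)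

/-- There is an idempotent ultrafilter of variable words all of whose substitution instances
coincide. -/
lemma exists_ultrafilter_variable_words [Finite α] :
    ∃ p : Ultrafilter (List (Option α)), (∀ᶠ v in (p : Filter (List (Option α))), none ∈ v) ∧
      (∀ (Q : List α → Prop) (a b : α),
        (∀ᶠ v in p, Q (subst a v)) → ∀ᶠ v in p, Q (subst b v)) ∧
      ∀ Q : List (Option α) → Prop,
        (∀ᶠ v in p, Q v) ↔ ∀ᶠ v in p, ∀ᶠ w in p, Q (v ++ w) := by
  let : Semigroup (List (Option α)) :=
    { mul := (· ++ ·), mul_assoc := List.append_assoc }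
  let := Ultrafilter.semigroup (M := List (Option α))
  let E : Set (List α) → Set (List (Option α)) :=
    fun s => {v | none ∈ v ∧ ∀ a b, subst a v ∈ s ↔ subst b v ∈ s}
  let P : Set (Ultrafilter (List (Option α))) := {p | ∀ s, E s ∈ p}
  have hne : P.Nonempty := by
    obtain ⟨p, hp⟩ := Ultrafilter.exists_ultrafilter_of_finite_inter_nonempty (Set.range E)
      (by
        intro T hT
        have hT' : ∀ t : T, ∃ s, E s = t := fun t => hT t.2
        choose s hs using hT'
        obtain ⟨v, hv, h⟩ := exists_indistinguishing_word s
        refine ⟨v, fun t ht => ?_⟩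
        rw [← show E (s ⟨t, ht⟩) = t from hs ⟨t, ht⟩]
        exact ⟨hv, h ⟨t, ht⟩⟩)
    exact ⟨p, fun s => hp ⟨s, rfl⟩⟩
  have hclosed : IsClosed P := by
    have : P = ⋂ s, {p | E s ∈ p} := by ext; simp [P]
    rw [this]
    exact isClosed_iInter fun s => ultrafilter_isClosed_basic _
  have hmul : ∀ p ∈ P, ∀ q ∈ P, p * q ∈ P := by
    intro p hp q hq s
    change ∀ᶠ v in p, ∀ᶠ w in q, v ++ w ∈ E s
    rcases isEmpty_or_nonempty α with hα | ⟨⟨a₀⟩⟩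
    · filter_upwards [hp s] with v hv
      exact Filter.Eventually.of_forall fun w =>
        ⟨List.mem_append_left _ hv.1, fun a => hα.elim a⟩
    filter_upwards [hp {t | ∀ᶠ w in q, t ++ subst a₀ w ∈ s}] with v hv
    have h1 : ∀ a, ∀ᶠ w in q, subst a v ++ subst a w ∈ s ↔
        ∀ᶠ w in q, subst a₀ v ++ subst a₀ w ∈ s := by
      intro a
      have h2 := hv.2 a a₀
      simp only [Set.mem_ofPred_eq] at h2
      rw [← h2]
      have h3 : ∀ᶠ w in q, subst a v ++ subst a₀ w ∈ s ↔
          ∀ᶠ w in q, subst a v ++ subst a₀ w ∈ s := by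
        by_cases h : ∀ᶠ w in q, subst a v ++ subst a₀ w ∈ s
        · filter_upwards [h] with w hw
          simp [hw, h]
        · filter_upwards [Ultrafilter.eventually_not.2 h] with w hw
          simp [hw, h]
      filter_upwards [h3, hq {t | subst a v ++ t ∈ s}] with w hw hw'
      rw [← hw]
      exact hw'.2 a a₀
    filter_upwards [Filter.eventually_all.2 h1] with w hw
    refine ⟨List.mem_append_left _ hv.1, fun a b => ?_⟩
    rw [subst_append, subst_append, hw a, hw b]
  obtain ⟨p, hp, hpp⟩ := exists_idempotent_in_compact_subsemigroup
    Ultrafilter.continuous_mul_left P hne hclosed.isCompact hmul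
  refine ⟨p, ?_, ?_, ?_⟩
  · filter_upwards [hp ∅] with v hv using hv.1
  · intro Q a b h
    filter_upwards [h, hp {t | Q t}] with v h1 h2
    exact (h2.2 a b).1 h1
  · intro Q
    conv_lhs => rw [← hpp]
    rfl

/-- Successive concatenation of `w` with the variable words `v 0, v 1, …`, in which the letters
`a 0, a 1, …` have been substituted. -/
def wordPrefix (w : List α) (v : ℕ → List (Option α)) (a : ℕ → α) : ℕ → List α
  | 0 => w
  | j + 1 => wordPrefix w v a j ++ subst (a j) (v j)

/-- **Carlson–Simpson theorem** for finite colorings of words. -/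
theorem exists_carlson_simpson_sequence [Finite α] [Nonempty α] {C : Type} [Finite C]
    (F : List α → C) :
    ∃ (w : List α) (v : ℕ → List (Option α)) (κ : C), (∀ j, none ∈ v j) ∧
      ∀ a j, F (wordPrefix w v a j ++ initialPart (v j)) = κ := by
  obtain ⟨p, hvar, hsub, hidem⟩ := exists_ultrafilter_variable_words (α := α)
  obtain ⟨a₀⟩ := ‹Nonempty α›
  have hcol : ∀ f : List (Option α) → C, ∃ κ, ∀ᶠ v in p, f v = κ := by
    intro f
    by_contra h
    rw [not_exists] at h
    have h' : ∀ᶠ v in p, ∀ κ, f v ≠ κ :=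
      Filter.eventually_all.2 fun κ => Ultrafilter.eventually_not.2 (h κ)
    obtain ⟨v, hv⟩ := h'.exists
    exact hv _ rfl
  choose κ' hκ' using fun t : List α => hcol fun v => F (t ++ initialPart v)
  obtain ⟨κ, hκ⟩ := hcol fun v => κ' (subst a₀ v)
  let G : List α → Prop := fun t => ∀ᶠ v in p, F (t ++ initialPart v) = κ
  let H : List α → Prop := fun t => G t ∧ ∀ a, ∀ᶠ v in p, G (t ++ subst a v)
  have hG : ∀ᶠ v in p, G (subst a₀ v) := by
    filter_upwards [hκ] with v hv
    simpa [G, ← hv] using hκ' (subst a₀ v)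
  have hGH : ∀ t, (∀ᶠ v in p, G (t ++ subst a₀ v)) → ∀ a, ∀ᶠ v in p, H (t ++ subst a v) := by
    intro t ht a
    refine hsub (fun w => H (t ++ w)) a₀ a ?_
    refine ht.and ?_
    rw [hidem] at ht
    filter_upwards [ht] with v hv b
    refine hsub (fun w => G (t ++ subst a₀ v ++ w)) a₀ b ?_
    filter_upwards [hv] with w hw
    rwa [subst_append, ← List.append_assoc] at hw
  have hH : ∃ w, H w := (hGH [] (by simpa using hG) a₀).exists.imp' (subst a₀) (by simp)
  obtain ⟨w, hw⟩ := hH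
  have step : ∀ T : Finset (List α), ∃ v : List (Option α), (∀ t ∈ T, H t) →
      none ∈ v ∧ ∀ t ∈ T, F (t ++ initialPart v) = κ ∧ ∀ a, H (t ++ subst a v) := by
    intro T
    by_cases hT : ∀ t ∈ T, H t
    · have h : ∀ᶠ v in p, ∀ t ∈ T, F (t ++ initialPart v) = κ ∧ ∀ a, H (t ++ subst a v) := by
        refine (Filter.eventually_all_finset T).2 fun t ht => ?_
        exact (hT t ht).1.and (Filter.eventually_all.2 (hGH t ((hT t ht).2 a₀)))
      obtain ⟨v, hv⟩ := (hvar.and h).exists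
      exact ⟨v, fun _ => hv⟩
    · exact ⟨[], fun h => (hT h).elim⟩
  choose next hnext using step
  classical
  cases nonempty_fintype α
  let T : ℕ → Finset (List α) := fun j => Nat.rec {w}
    (fun _ T => (T ×ˢ (Finset.univ : Finset α)).image fun x => x.1 ++ subst x.2 (next T)) j
  have hT1 : ∀ j t a, t ∈ T j → t ++ subst a (next (T j)) ∈ T (j + 1) := by
    intro j t a ht
    exact Finset.mem_image.2 ⟨(t, a), Finset.mem_product.2 ⟨ht, Finset.mem_univ _⟩, rfl⟩
  have hT : ∀ j, ∀ t ∈ T j, H t := by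
    intro j
    induction j with
    | zero => intro t ht; rw [Finset.mem_singleton.1 ht]; exact hw
    | succ j ih =>
      intro t ht
      obtain ⟨⟨t', a⟩, h, rfl⟩ := Finset.mem_image.1 ht
      exact ((hnext _ ih).2 t' (Finset.mem_product.1 h).1).2 a
  refine ⟨w, fun j => next (T j), κ, fun j => (hnext _ (hT j)).1, fun a j => ?_⟩
  have hmem : wordPrefix w (fun j => next (T j)) a j ∈ T j := by
    induction j with
    | zero => exact Finset.mem_singleton_self _
    | succ j ih => exact hT1 j _ _ ih
  exact ((hnext _ (hT j)).2 _ hmem).1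

end Words

/-! ### Rigid surjections -/

/-- A rigid surjection of `ℕ`: the first occurrences of the values `0, 1, 2, …` come in
increasing order. -/
def IsRigid (f : ℕ → ℕ) : Prop :=
  Function.Surjective f ∧ ∀ x, ∀ y < f x, ∃ z < x, f z = y

/-- `f` is the identity on `{0, …, n - 1}`. -/
def FixesBelow (n : ℕ) (f : ℕ → ℕ) : Prop :=
  ∀ i < n, f i = i

/-- On rigid surjections fixing `{0, …, n - 1}`, the value of `χ` only depends on the restriction
up to the first occurrence of `m`. -/
def IsLocal {C : Type} (n m : ℕ) (χ : (ℕ → ℕ) → C) : Prop :=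
  ∀ f g, IsRigid f → FixesBelow n f → IsRigid g → FixesBelow n g →
    ∀ N, f N = m → (∀ x ≤ N, f x = g x) → χ f = χ g

lemma isRigid_id : IsRigid id :=
  ⟨Function.surjective_id, fun _ y hy => ⟨y, hy, rfl⟩⟩

lemma IsRigid.comp {f g : ℕ → ℕ} (hf : IsRigid f) (hg : IsRigid g) : IsRigid (f ∘ g) := by
  refine ⟨hf.1.comp hg.1, fun x y hy => ?_⟩
  obtain ⟨z, hz, rfl⟩ := hf.2 _ _ hy
  obtain ⟨w, hw, rfl⟩ := hg.2 _ _ hz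
  exact ⟨w, hw, rfl⟩

lemma FixesBelow.comp {n : ℕ} {f g : ℕ → ℕ} (hf : FixesBelow n f) (hg : FixesBelow n g) :
    FixesBelow n (f ∘ g) := fun i hi => by
  rw [Function.comp_apply, hg i hi, hf i hi]

lemma FixesBelow.mono {n m : ℕ} {f : ℕ → ℕ} (hf : FixesBelow m f) (h : n ≤ m) :
    FixesBelow n f := fun i hi => hf i (hi.trans_le h)

lemma IsRigid.le_self {f : ℕ → ℕ} (hf : IsRigid f) (x : ℕ) : f x ≤ x := by
  induction x using Nat.strong_induction_on with
  | _ x ih =>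
    by_contra! h
    obtain ⟨z, hz, hzx⟩ := hf.2 x x h
    have := ih z hz
    omega

/-- Every value `y` of a rigid surjection has a first occurrence, before which all values are
smaller than `y`. -/
lemma IsRigid.exists_first {f : ℕ → ℕ} (hf : IsRigid f) (y : ℕ) :
    ∃ x, f x = y ∧ ∀ z < x, f z < y := by
  classical
  refine ⟨Nat.find (hf.1 y), Nat.find_spec (hf.1 y), fun z hz => ?_⟩
  have h1 := Nat.find_min (hf.1 y) hz
  by_contra! h
  obtain ⟨w, hw, hwy⟩ := hf.2 z y (lt_of_le_of_ne h (Ne.symm h1))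
  exact Nat.find_min (hf.1 y) (hw.trans hz) hwy

/-- The limit of an increasing sequence of words. -/
lemma exists_limit_word {P : ℕ → List ℕ} (hP : ∀ j, P j <+: P (j + 1))
    (hlen : ∀ j, j ≤ (P j).length) :
    ∃ W : ℕ → ℕ, ∀ j x y, (P j)[x]? = some y → W x = y := by
  have hmono : ∀ i j, i ≤ j → P i <+: P j := by
    intro i j hij
    induction hij with
    | refl => exact List.prefix_refl _
    | step _ ih => exact ih.trans (hP _)
  refine ⟨fun x => (P (x + 1)).getD x 0, fun j x y h => ?_⟩
  have hx : (P (x + 1))[x]? = some y := by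
    rcases le_total j (x + 1) with hj | hj
    · obtain ⟨t, ht⟩ := hmono _ _ hj
      rw [← ht, List.getElem?_append_left (List.getElem?_eq_some_iff.1 h).1, h]
    · obtain ⟨t, ht⟩ := hmono _ _ hj
      rwa [← ht, List.getElem?_append_left (hlen (x + 1))] at h
  simp [List.getD, hx]

/-- A criterion for the limit of an increasing sequence of words to be rigid. -/
lemma exists_rigid_limit {n : ℕ} {w : List ℕ} {P : ℕ → List ℕ} (h0 : P 0 = List.range n ++ w)
    (hw : ∀ y ∈ w, y < n)
    (hP : ∀ j, ∃ q, P (j + 1) = P j ++ q ∧ n + j ∈ q ∧ ∀ y ∈ q, y ≤ n + j) :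
    ∃ W : ℕ → ℕ, IsRigid W ∧ FixesBelow n W ∧ ∀ j x y, (P j)[x]? = some y → W x = y := by
  have hmem : ∀ j y, y ∈ P j ↔ y < n + j := by
    intro j
    induction j with
    | zero =>
      intro y
      rw [h0, List.mem_append, List.mem_range, add_zero]
      exact ⟨fun h => h.elim id (hw y), Or.inl⟩
    | succ j ih =>
      intro y
      obtain ⟨q, hq, hj, hle⟩ := hP j
      rw [hq, List.mem_append, ih]
      constructor
      · rintro (h | h)
        · omega
        · have := hle y h
          omega
      · intro h
        rcases Nat.lt_succ_iff_lt_or_eq.1 (show y < (n + j).succ by omega) with h | rfl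
        · exact Or.inl h
        · exact Or.inr hj
  have hlen : ∀ j, j ≤ (P j).length := by
    intro j
    induction j with
    | zero => exact Nat.zero_le _
    | succ j ih =>
      obtain ⟨q, hq, hj, -⟩ := hP j
      have := List.length_pos_of_mem hj
      rw [hq, List.length_append]
      omega
  obtain ⟨W, hW⟩ := exists_limit_word (P := P)
    (fun j => by obtain ⟨q, hq, -⟩ := hP j; exact ⟨q, hq.symm⟩) hlen
  have hfix : FixesBelow n W := by
    intro i hi
    refine hW 0 i i ?_
    rw [h0, List.getElem?_append_left (by simpa using hi)]
    simp [hi]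
  have hval : ∀ j y, y < n + j → ∃ z < (P j).length, W z = y := by
    intro j y h
    obtain ⟨z, hz⟩ := List.mem_iff_getElem?.1 ((hmem j y).2 h)
    exact ⟨z, (List.getElem?_eq_some_iff.1 hz).1, hW j z y hz⟩
  have hlt : ∀ j x, x < (P j).length → W x < n + j := by
    intro j x hx
    have h1 : (P j)[x]? = some (P j)[x] := List.getElem?_eq_getElem hx
    rw [hW j x _ h1]
    exact (hmem j _).1 (List.getElem_mem hx)
  refine ⟨W, ⟨fun y => ?_, fun x y hy => ?_⟩, hfix, hW⟩
  · obtain ⟨z, -, hz⟩ := hval (y + 1) y (by omega)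
    exact ⟨z, hz⟩
  · by_cases hxn : x < n
    · rw [hfix x hxn] at hy
      exact ⟨y, hy, hfix y (hy.trans hxn)⟩
    classical
    have hex : ∃ j, x < (P j).length := ⟨x + 1, hlen (x + 1)⟩
    rcases h : Nat.find hex with _ | j
    · have h1 := Nat.find_spec hex
      rw [h] at h1
      have h2 := hlt 0 x h1
      exact ⟨y, by omega, hfix y (by omega)⟩
    · have h1 := Nat.find_spec hex
      rw [h] at h1
      have h2 := hlt _ x h1
      have h3 := Nat.find_min hex (m := j) (by omega)
      obtain ⟨z, hz, hzy⟩ := hval j y (by omega)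
      exact ⟨z, by omega, hzy⟩

/-- The rigid surjection which starts with `0, …, n - 1` and the word `t`, and which then
continues with `n, n + 1, …`. -/
def extendWord (n : ℕ) (t : List ℕ) (x : ℕ) : ℕ :=
  (List.range n ++ t)[x]?.getD (x - t.length)

lemma extendWord_of_ge {n : ℕ} {t : List ℕ} {x : ℕ} (h : n + t.length ≤ x) :
    extendWord n t x = x - t.length := by
  rw [extendWord, List.getElem?_eq_none (by simpa using h), Option.getD_none]

lemma fixesBelow_extendWord (n : ℕ) (t : List ℕ) : FixesBelow n (extendWord n t) := by
  intro i hi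
  rw [extendWord, List.getElem?_append_left (by simpa using hi)]
  simp [hi]

lemma isRigid_extendWord {n : ℕ} {t : List ℕ} (ht : ∀ y ∈ t, y < n) :
    IsRigid (extendWord n t) := by
  have hfix := fixesBelow_extendWord n t
  refine ⟨fun y => ?_, fun x y hy => ?_⟩
  · by_cases h : y < n
    · exact ⟨y, hfix y h⟩
    · exact ⟨y + t.length, by rw [extendWord_of_ge (by omega)]; omega⟩
  · by_cases hxn : x < n
    · rw [hfix x hxn] at hy
      exact ⟨y, hy, hfix y (hy.trans hxn)⟩
    by_cases hyn : y < n
    · exact ⟨y, by omega, hfix y hyn⟩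
    by_cases hx : n + t.length ≤ x
    · rw [extendWord_of_ge hx] at hy
      exact ⟨y + t.length, by omega, by rw [extendWord_of_ge (by omega)]; omega⟩
    · have hx' : x < (List.range n ++ t).length := by simpa using hx
      rw [extendWord, List.getElem?_eq_getElem hx', Option.getD_some] at hy
      have := List.getElem_mem hx'
      rw [List.mem_append, List.mem_range] at this
      have := this.elim id (ht _)
      omega

lemma eq_initialPart_append {α : Type} {v : List (Option α)} (hv : none ∈ v) :
    ∃ r, v = (initialPart v).map some ++ none :: r := by
  induction v with
  | nil => simp at hv
  | cons o v ih =>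
    cases o with
    | none => exact ⟨v, by simp [initialPart]⟩
    | some a =>
      obtain ⟨r, hr⟩ := ih (by simpa using hv)
      refine ⟨r, ?_⟩
      conv_lhs => rw [hr]
      simp [initialPart]

/-- The Carlson–Simpson theorem for colorings which depend on the word in front of the first
occurrence of `n`. -/
lemma exists_homogeneous_base {C : Type} [Finite C] (n : ℕ) {χ : (ℕ → ℕ) → C}
    (hχ : IsLocal n n χ) :
    ∃ W, IsRigid W ∧ FixesBelow n W ∧
      ∃ κ, ∀ u, IsRigid u → FixesBelow n u → χ (u ∘ W) = κ := by
  rcases Nat.eq_zero_or_pos n with rfl | hn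
  · refine ⟨id, isRigid_id, fun _ _ => rfl, χ id, fun u hu _ => ?_⟩
    have h0 : u 0 = 0 := Nat.le_zero.1 (hu.le_self 0)
    exact hχ _ _ hu (fun i hi => absurd hi (Nat.not_lt_zero i)) isRigid_id (fun _ _ => rfl) 0 h0
      fun x hx => by rw [Nat.le_zero.1 hx]; exact h0
  have : Nonempty (Fin n) := ⟨⟨0, hn⟩⟩
  obtain ⟨w, v, κ, hv, hκ⟩ := exists_carlson_simpson_sequence
    fun t : List (Fin n) => χ (extendWord n (t.map Fin.val))
  let q : ℕ → List ℕ := fun j => (v j).map fun o => (o.map Fin.val).getD (n + j)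
  let P : ℕ → List ℕ := fun j => Nat.rec (List.range n ++ w.map Fin.val) (fun j l => l ++ q j) j
  obtain ⟨W, hW, hfix, hWP⟩ := exists_rigid_limit (n := n) (w := w.map Fin.val) (P := P) rfl
    (by simp) fun j => ⟨q j, rfl, List.mem_map.2 ⟨none, hv j, rfl⟩, by
      intro y hy
      obtain ⟨o, -, rfl⟩ := List.mem_map.1 hy
      cases o with
      | none => simp
      | some a =>
        have := a.2
        simp only [Option.map_some, Option.getD_some]
        omega⟩
  refine ⟨W, hW, hfix, κ, fun u hu hun => ?_⟩
  obtain ⟨L, hL, hLlt⟩ := hu.exists_first n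
  have hnL : n ≤ L := by
    by_contra! h
    rw [hun L h] at hL
    omega
  obtain ⟨j, rfl⟩ := Nat.exists_eq_add_of_le hnL
  let a : ℕ → Fin n := fun i => if h : i < j then ⟨u (n + i), hLlt _ (by omega)⟩ else ⟨0, hn⟩
  have hmapq : ∀ i < j, (q i).map u = (subst (a i) (v i)).map Fin.val := by
    intro i hi
    simp only [q, subst, List.map_map]
    refine List.map_congr_left fun o _ => ?_
    cases o with
    | none => simp [a, hi]
    | some b => simp [hun b b.2]
  have hmapP : ∀ i ≤ j, (P i).map u =
      List.range n ++ (wordPrefix w v a i).map Fin.val := by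
    intro i
    induction i with
    | zero =>
      intro _
      change (List.range n ++ w.map Fin.val).map u = List.range n ++ w.map Fin.val
      conv_rhs => rw [← List.map_id (List.range n ++ w.map Fin.val)]
      refine List.map_congr_left fun y hy => hun y ?_
      simp only [List.mem_append, List.mem_range, List.mem_map] at hy
      rcases hy with hy | ⟨b, -, rfl⟩
      · exact hy
      · exact b.2
    | succ i ih =>
      intro hi
      change (P i ++ q i).map u = List.range n ++ (wordPrefix w v a i ++ _).map Fin.val
      rw [List.map_append, List.map_append, ih (by omega), hmapq i (by omega),
        List.append_assoc]
  obtain ⟨r, hr⟩ := eq_initialPart_append (hv j)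
  have hκt := hκ a j
  obtain ⟨t, ht⟩ : ∃ t, t = wordPrefix w v a j ++ initialPart (v j) := ⟨_, rfl⟩
  rw [← ht] at hκt
  have hPsucc : ∃ r', (P (j + 1)).map u = (List.range n ++ t.map Fin.val) ++ n :: r' := by
    refine ⟨(r.map fun o => (o.map Fin.val).getD (n + j)).map u, ?_⟩
    change (P j ++ (v j).map _).map u = _
    rw [hr, List.map_append, hmapP j le_rfl, ht]
    simp only [List.map_append, List.map_map, List.map_cons, List.append_assoc,
      Option.map_none, Option.getD_none, hL]
    congr 3
    exact List.map_congr_left fun b _ => by simp [hun b b.2]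
  obtain ⟨r', hr'⟩ := hPsucc
  have huW : ∀ x y, ((P (j + 1)).map u)[x]? = some y → u (W x) = y := by
    intro x y h
    rw [List.getElem?_map, Option.map_eq_some_iff] at h
    obtain ⟨z, hz, rfl⟩ := h
    rw [hWP (j + 1) x z hz]
  rw [hr'] at huW
  set l := List.range n ++ t.map Fin.val with hl
  have hlen : l.length = n + t.length := by simp [hl]
  have hN : u (W l.length) = n := huW _ _ (by simp)
  rw [← hκt]
  refine hχ _ _ (hu.comp hW) (hun.comp hfix) (isRigid_extendWord (by simp))
    (fixesBelow_extendWord _ _) l.length hN fun x hx => ?_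
  rcases Nat.lt_or_eq_of_le hx with hx | rfl
  · refine huW x _ ?_
    rw [List.getElem?_append_left hx, extendWord, ← hl, List.getElem?_eq_getElem hx,
      Option.getD_some]
  · rw [extendWord_of_ge (by simp [hlen])]
    rw [Function.comp_apply, hN, hlen, List.length_map, Nat.add_sub_cancel]

/-- Infinite compositions of rigid surjections, the later of which fix longer and longer initial
segments. -/
lemma exists_fusion {V : ℕ → ℕ → ℕ} (hV : ∀ j, IsRigid (V j)) (hfix : ∀ j, FixesBelow j (V j)) :
    ∃ Y : ℕ → ℕ → ℕ, (∀ j, IsRigid (Y j)) ∧ (∀ n j, (∀ i, j ≤ i → FixesBelow n (V i)) →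
      FixesBelow n (Y j)) ∧ ∀ j, Y j = Y (j + 1) ∘ V j := by
  let Z : ℕ → ℕ → ℕ → ℕ := fun j i => Nat.rec id (fun i f => V (j + i) ∘ f) i
  have hZrigid : ∀ j i, IsRigid (Z j i) := by
    intro j i
    induction i with
    | zero => exact isRigid_id
    | succ i ih => exact (hV _).comp ih
  have hstable : ∀ j i d x, Z j i x < j + i → Z j (i + d) x = Z j i x := by
    intro j i d x h
    induction d with
    | zero => rfl
    | succ d ih =>
      change V (j + (i + d)) (Z j (i + d) x) = _
      rw [ih]
      exact hfix _ _ (by omega)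
  have hYZ : ∀ j i x, x < i → Z j i x = Z j (x + 1) x := by
    intro j i x h
    obtain ⟨d, rfl⟩ := Nat.exists_eq_add_of_le (Nat.succ_le_of_lt h)
    have := (hZrigid j (x + 1)).le_self x
    exact hstable j (x + 1) d x (by omega)
  have hcomp : ∀ j i, Z j (i + 1) = Z (j + 1) i ∘ V j := by
    intro j i
    induction i with
    | zero => rfl
    | succ i ih =>
      change V (j + (i + 1)) ∘ Z j (i + 1) = (V (j + 1 + i) ∘ Z (j + 1) i) ∘ V j
      rw [ih, show j + (i + 1) = j + 1 + i by omega]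
      rfl
  refine ⟨fun j x => Z j (x + 1) x, fun j => ⟨fun y => ?_, fun x y hy => ?_⟩,
    fun n j h i hi => ?_, fun j => funext fun x => ?_⟩
  · obtain ⟨x, hx⟩ := (hZrigid j (y + 1)).1 y
    refine ⟨x, ?_⟩
    change Z j (x + 1) x = y
    rw [← hYZ j (x + 1 + (y + 1)) x (by omega), Nat.add_comm,
      hstable j (y + 1) (x + 1) x (by omega), hx]
  · obtain ⟨z, hz, rfl⟩ := (hZrigid j (x + 1)).2 x y hy
    exact ⟨z, hz, (hYZ j (x + 1) z (by omega)).symm⟩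
  · have : ∀ d, Z j d i = i := by
      intro d
      induction d with
      | zero => rfl
      | succ d ih =>
        change V (j + d) (Z j d i) = i
        rw [ih]
        exact h _ (by omega) i hi
    exact this (i + 1)
  · have := (hV j).le_self x
    change Z j (x + 1) x = Z (j + 1) (V j x + 1) (V j x)
    rw [← hYZ j (x + 1 + 1) x (by omega), hcomp, Function.comp_apply,
      hYZ (j + 1) (x + 1) (V j x) (by omega)]

lemma extendWord_lt {n : ℕ} {t : List ℕ} (ht : ∀ y ∈ t, y < n) {x : ℕ} (hx : x < n + t.length) :
    extendWord n t x < n := by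
  have hx' : x < (List.range n ++ t).length := by simpa using hx
  rw [extendWord, List.getElem?_eq_getElem hx', Option.getD_some]
  have := List.getElem_mem hx'
  rw [List.mem_append, List.mem_range] at this
  exact this.elim id (ht _)

/-- The color of `u ∘ W` is the same for all rigid surjections `u` which start with the word
`0, …, n - 1`, `t`, `n`. -/
def IsHomogeneousOn {C : Type} (n : ℕ) (χ : (ℕ → ℕ) → C) (W : ℕ → ℕ) (t : List ℕ) : Prop :=
  ∃ κ, ∀ u, IsRigid u → FixesBelow n u → (∀ x < n + t.length, u x = extendWord n t x) →
    u (n + t.length) = n → χ (u ∘ W) = κ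

lemma IsHomogeneousOn.comp {C : Type} {n : ℕ} {χ : (ℕ → ℕ) → C} {W V : ℕ → ℕ} {t : List ℕ}
    (h : IsHomogeneousOn n χ W t) (hV : IsRigid V) (hfix : FixesBelow (n + t.length + 1) V) :
    IsHomogeneousOn n χ (V ∘ W) t := by
  obtain ⟨κ, hκ⟩ := h
  refine ⟨κ, fun u hu hun hut huL => hκ (u ∘ V) (hu.comp hV)
    (hun.comp (hfix.mono (by omega))) (fun x hx => ?_) ?_⟩
  · rw [Function.comp_apply, hfix x (by omega), hut x hx]
  · rw [Function.comp_apply, hfix _ (by omega), huL]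

/-- Every coloring as described by `IsLocal` is constant on the `u ∘ W`, for some `W`. -/
def HasHomogeneous (n m : ℕ) : Prop :=
  ∀ (C : Type) [Finite C] (χ : (ℕ → ℕ) → C), IsLocal n m χ →
    ∃ W, IsRigid W ∧ FixesBelow n W ∧
      ∃ κ, ∀ u, IsRigid u → FixesBelow n u → χ (u ∘ W) = κ

/-- Transport of a rigid surjection along the extension of a word. -/
lemma exists_lift_extendWord {n : ℕ} {t : List ℕ} (ht : ∀ y ∈ t, y < n) {V : ℕ → ℕ}
    (hV : IsRigid V) (hfix : FixesBelow (n + 1) V) :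
    ∃ V', IsRigid V' ∧ FixesBelow (n + t.length + 1) V' ∧
      extendWord n t ∘ V' = V ∘ extendWord n t := by
  set L := n + t.length with hL
  let V' : ℕ → ℕ := fun x =>
    if x < L then x else if n ≤ V (n + (x - L)) then L + (V (n + (x - L)) - n)
      else V (n + (x - L))
  have h1 : ∀ x < L + 1, V' x = x := by
    intro x hx
    rcases Nat.lt_succ_iff_lt_or_eq.1 hx with h | rfl
    · simp [V', h]
    · simp [V', hfix n (by omega)]
  have h2 : ∀ i, n ≤ V (n + i) → V' (L + i) = L + (V (n + i) - n) := by
    intro i hi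
    simp [V', hi]
  have h3 : ∀ i, V (n + i) < n → V' (L + i) = V (n + i) := by
    intro i hi
    simp [V', Nat.not_le.2 hi]
  have hpre : ∀ x, n ≤ V x → ∃ i, x = n + i := by
    intro x hx
    by_contra! h
    by_cases hxn : n ≤ x
    · exact h (x - n) (by omega)
    · rw [hfix x (by omega)] at hx
      omega
  refine ⟨V', ⟨fun y => ?_, fun x y hy => ?_⟩, h1, funext fun x => ?_⟩
  · by_cases hy : y < L + 1
    · exact ⟨y, h1 y hy⟩
    · obtain ⟨x, hx⟩ := hV.1 (n + (y - L))
      obtain ⟨i, rfl⟩ := hpre x (by omega)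
      exact ⟨L + i, by rw [h2 i (by omega)]; omega⟩
  · by_cases hx : x < L + 1
    · rw [h1 x hx] at hy
      exact ⟨y, hy, h1 y (hy.trans hx)⟩
    by_cases hyL : y < L + 1
    · exact ⟨y, by omega, h1 y hyL⟩
    obtain ⟨i, rfl⟩ := Nat.exists_eq_add_of_le (show L ≤ x by omega)
    by_cases hi : n ≤ V (n + i)
    · rw [h2 i hi] at hy
      obtain ⟨z, hz, hzy⟩ := hV.2 (n + i) (n + (y - L)) (by omega)
      obtain ⟨k, rfl⟩ := hpre z (by omega)
      exact ⟨L + k, by omega, by rw [h2 k (by omega)]; omega⟩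
    · rw [h3 i (by omega)] at hy
      omega
  · simp only [Function.comp_apply]
    by_cases hx : x < L
    · rw [h1 x (by omega), hfix _ (Nat.lt_succ_of_lt (extendWord_lt ht hx))]
    obtain ⟨i, rfl⟩ := Nat.exists_eq_add_of_le (show L ≤ x by omega)
    have he : ∀ i, extendWord n t (L + i) = n + i := fun i => by
      rw [extendWord_of_ge (by omega)]
      omega
    rw [he]
    by_cases hi : n ≤ V (n + i)
    · rw [h2 i hi, he]
      omega
    · rw [h3 i (by omega), fixesBelow_extendWord n t _ (by omega)]

/-- A rigid surjection extending a given word factors through the extension of this word. -/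
lemma exists_factor_extendWord {n : ℕ} {t : List ℕ} (ht : ∀ y ∈ t, y < n) {u : ℕ → ℕ}
    (hu : IsRigid u) (hut : ∀ x < n + t.length, u x = extendWord n t x)
    (huL : u (n + t.length) = n) :
    ∃ u', IsRigid u' ∧ FixesBelow (n + 1) u' ∧ u = u' ∘ extendWord n t := by
  set L := n + t.length with hL
  let u' : ℕ → ℕ := fun x => if x < n then x else u (L + (x - n))
  have h1 : ∀ x < n + 1, u' x = x := by
    intro x hx
    rcases Nat.lt_succ_iff_lt_or_eq.1 hx with h | rfl
    · simp [u', h]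
    · simp [u', huL]
  have h2 : ∀ i, u' (n + i) = u (L + i) := by
    intro i
    simp [u']
  have hpre : ∀ x, n ≤ u x → ∃ i, x = L + i := by
    intro x hx
    by_cases h : L ≤ x
    · exact Nat.exists_eq_add_of_le h
    · have := extendWord_lt ht (x := x) (by omega)
      rw [hut x (by omega)] at hx
      omega
  refine ⟨u', ⟨fun y => ?_, fun x y hy => ?_⟩, h1, funext fun x => ?_⟩
  · by_cases hy : y < n + 1
    · exact ⟨y, h1 y hy⟩
    · obtain ⟨x, rfl⟩ := hu.1 y
      obtain ⟨i, rfl⟩ := hpre x (by omega)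
      exact ⟨n + i, h2 i⟩
  · by_cases hx : x < n + 1
    · rw [h1 x hx] at hy
      exact ⟨y, hy, h1 y (hy.trans hx)⟩
    by_cases hyn : y < n + 1
    · exact ⟨y, by omega, h1 y hyn⟩
    obtain ⟨i, rfl⟩ := Nat.exists_eq_add_of_le (show n ≤ x by omega)
    rw [h2] at hy
    obtain ⟨z, hz, rfl⟩ := hu.2 _ _ hy
    obtain ⟨k, rfl⟩ := hpre z (by omega)
    exact ⟨n + k, by omega, h2 k⟩
  · rw [Function.comp_apply]
    by_cases hx : x < L
    · rw [h1 _ (Nat.lt_succ_of_lt (extendWord_lt ht hx)), hut x hx]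
    obtain ⟨i, rfl⟩ := Nat.exists_eq_add_of_le (show L ≤ x by omega)
    rw [extendWord_of_ge (by omega), ← h2]
    congr 1
    omega

lemma IsLocal.comp_right {C : Type} {n m : ℕ} {χ : (ℕ → ℕ) → C} (hχ : IsLocal n m χ) {e : ℕ → ℕ}
    (he : IsRigid e) (hfix : FixesBelow n e) : IsLocal n m fun u => χ (u ∘ e) := by
  intro f g hf hfn hg hgn N hN hfg
  obtain ⟨x, hx, hlt⟩ := he.exists_first N
  refine hχ _ _ (hf.comp he) (hfn.comp hfix) (hg.comp he) (hgn.comp hfix) x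
    (by rw [Function.comp_apply, hx, hN]) fun z hz => hfg _ ?_
  rcases Nat.lt_or_eq_of_le hz with h | rfl
  · exact (hlt z h).le
  · exact hx.le

lemma IsLocal.mono {C : Type} {n n' m : ℕ} {χ : (ℕ → ℕ) → C} (hχ : IsLocal n m χ)
    (h : n ≤ n') : IsLocal n' m χ :=
  fun f g hf hfn hg hgn => hχ f g hf (hfn.mono h) hg (hgn.mono h)

lemma HasHomogeneous.exists_homogeneousOn {n m : ℕ} (h : HasHomogeneous (n + 1) m) {C : Type}
    [Finite C] {χ : (ℕ → ℕ) → C} (hχ : IsLocal n m χ) {W : ℕ → ℕ} (hW : IsRigid W)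
    (hWn : FixesBelow n W) {t : List ℕ} (ht : ∀ y ∈ t, y < n) :
    ∃ V, IsRigid V ∧ FixesBelow (n + t.length + 1) V ∧ IsHomogeneousOn n χ (V ∘ W) t := by
  have hloc := (hχ.comp_right ((isRigid_extendWord ht).comp hW)
    ((fixesBelow_extendWord n t).comp hWn)).mono (Nat.le_succ n)
  obtain ⟨V, hV, hVn, κ, hκ⟩ := h C _ hloc
  obtain ⟨V', hV', hV'n, hcomm⟩ := exists_lift_extendWord ht hV hVn
  refine ⟨V', hV', hV'n, κ, fun u hu hun hut huL => ?_⟩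
  obtain ⟨u', hu', hu'n, rfl⟩ := exists_factor_extendWord ht hu hut huL
  rw [← hκ u' hu' hu'n]
  change χ (u' ∘ (extendWord n t ∘ V') ∘ W) = _
  rw [hcomm]
  rfl

lemma HasHomogeneous.exists_homogeneousOn_finset {n m : ℕ} (h : HasHomogeneous (n + 1) m)
    {C : Type} [Finite C] {χ : (ℕ → ℕ) → C} (hχ : IsLocal n m χ) {W : ℕ → ℕ} (hW : IsRigid W)
    (hWn : FixesBelow n W) (j : ℕ) (T : Finset (List ℕ)) :
    ∃ V, IsRigid V ∧ FixesBelow (n + j + 1) V ∧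
      ∀ t ∈ T, (∀ y ∈ t, y < n) → t.length = j → IsHomogeneousOn n χ (V ∘ W) t := by
  classical
  induction T using Finset.induction_on with
  | empty => exact ⟨id, isRigid_id, fun _ _ => rfl, by simp⟩
  | insert t T _ ih =>
    obtain ⟨V, hV, hVn, hVT⟩ := ih
    by_cases ht : (∀ y ∈ t, y < n) ∧ t.length = j
    · obtain ⟨ht, rfl⟩ := ht
      obtain ⟨V', hV', hV'n, hV't⟩ := h.exists_homogeneousOn hχ (hV.comp hW)
        ((hVn.mono (by omega)).comp hWn) ht
      refine ⟨V' ∘ V, hV'.comp hV, hV'n.comp hVn, fun s hs hsn hst => ?_⟩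
      rcases Finset.mem_insert.1 hs with rfl | hs
      · exact hV't
      · exact (hVT s hs hsn hst).comp hV' (by rwa [hst])
    · refine ⟨V, hV, hVn, fun s hs hsn hst => ?_⟩
      rcases Finset.mem_insert.1 hs with rfl | hs
      · exact absurd ⟨hsn, hst⟩ ht
      · exact hVT s hs hsn hst

lemma HasHomogeneous.of_succ {n m : ℕ} (h : HasHomogeneous (n + 1) m) : HasHomogeneous n m := by
  classical
  intro C _ χ hχ
  let T : ℕ → Finset (List ℕ) := fun j =>
    (Finset.univ : Finset (Fin j → Fin n)).image fun f => List.ofFn fun i => (f i : ℕ)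
  have step : ∀ (j : ℕ) (W : ℕ → ℕ), ∃ V, IsRigid V ∧ FixesBelow (n + j + 1) V ∧
      (IsRigid W → FixesBelow n W →
        ∀ t ∈ T j, (∀ y ∈ t, y < n) → t.length = j → IsHomogeneousOn n χ (V ∘ W) t) := by
    intro j W
    by_cases hW : IsRigid W ∧ FixesBelow n W
    · obtain ⟨V, hV, hVn, hVT⟩ := h.exists_homogeneousOn_finset hχ hW.1 hW.2 j (T j)
      exact ⟨V, hV, hVn, fun _ _ => hVT⟩
    · exact ⟨id, isRigid_id, fun _ _ => rfl, fun h1 h2 => absurd ⟨h1, h2⟩ hW⟩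
  choose V hV hVn hVT using step
  let W : ℕ → ℕ → ℕ := fun j => Nat.rec id (fun j f => V j f ∘ f) j
  have hW : ∀ j, IsRigid (W j) ∧ FixesBelow n (W j) := by
    intro j
    induction j with
    | zero => exact ⟨isRigid_id, fun _ _ => rfl⟩
    | succ j ih =>
      exact ⟨(hV j (W j)).comp ih.1, ((hVn j (W j)).mono (by omega)).comp ih.2⟩
  obtain ⟨Y, hY, hYn, hYV⟩ := exists_fusion (V := fun j => V j (W j)) (fun j => hV _ _)
    fun j => (hVn _ _).mono (by omega)
  have hYW : ∀ j, Y 0 = Y j ∘ W j := by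
    intro j
    induction j with
    | zero => rfl
    | succ j ih =>
      rw [ih, hYV j]
      rfl
  have hY0 : FixesBelow n (Y 0) := hYn n 0 fun i _ => (hVn _ _).mono (by omega)
  have hhom : ∀ j, ∀ t ∈ T j, (∀ y ∈ t, y < n) → t.length = j →
      IsHomogeneousOn n χ (Y 0) t := by
    intro j t ht htn htj
    rw [hYW (j + 1)]
    refine (hVT j (W j) (hW j).1 (hW j).2 t ht htn htj).comp (hY _)
      (hYn _ _ fun i hi => (hVn _ _).mono (by omega))
  have hloc : IsLocal n n fun u => χ (u ∘ Y 0) := by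
    intro f g hf hfn hg hgn N hN hfg
    obtain ⟨L, hL, hLlt⟩ := hf.exists_first n
    have hnL : n ≤ L := by
      by_contra! h
      rw [hfn L h] at hL
      omega
    have hLN : L ≤ N := by
      by_contra! h
      have := hLlt N h
      omega
    obtain ⟨j, rfl⟩ := Nat.exists_eq_add_of_le hnL
    let t : List ℕ := List.ofFn fun i : Fin j => f (n + i)
    have htj : t.length = j := List.length_ofFn
    have htn : ∀ y ∈ t, y < n := by
      intro y hy
      obtain ⟨i, rfl⟩ := List.mem_ofFn.1 hy
      exact hLlt _ (by omega)
    have htT : t ∈ T j :=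
      Finset.mem_image.2 ⟨fun i => ⟨f (n + i), hLlt _ (by omega)⟩, Finset.mem_univ _, rfl⟩
    have hft : ∀ x < n + t.length, f x = extendWord n t x := by
      intro x hx
      by_cases hxn : x < n
      · rw [hfn x hxn, fixesBelow_extendWord n t x hxn]
      · obtain ⟨i, rfl⟩ := Nat.exists_eq_add_of_le (not_lt.1 hxn)
        have hi : i < j := by omega
        simp [extendWord, t, hi]
    obtain ⟨κ, hκ⟩ := hhom j t htT htn htj
    refine (hκ f hf hfn hft (by rwa [htj])).trans (hκ g hg hgn (fun x hx => ?_) ?_).symm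
    · rw [← hft x hx, hfg x (by omega)]
    · rw [← hfg _ (by omega), htj, hL]
  obtain ⟨W', hW', hW'n, κ, hκ⟩ := exists_homogeneous_base n hloc
  exact ⟨W' ∘ Y 0, hW'.comp (hY 0), hW'n.comp hY0, κ, hκ⟩

/-- The **Carlson–Simpson theorem** for finite colorings of rigid surjections which depend on the
part in front of the first occurrence of `m`. -/
theorem hasHomogeneous_zero (m : ℕ) : HasHomogeneous 0 m := by
  suffices h : ∀ d n, HasHomogeneous n (n + d) by simpa using h m 0
  intro d
  induction d with
  | zero => exact fun n C _ χ hχ => exists_homogeneous_base n hχ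
  | succ d ih =>
    intro n
    refine HasHomogeneous.of_succ ?_
    rw [show n + (d + 1) = n + 1 + d by omega]
    exact ih (n + 1)

/-! ### Words and vertices -/

/-- Every countable graph embeds into a graph with the extension property. -/
lemma exists_embedding {R : SimpleGraph ℕ} (hR : ExtensionProperty R) {X : Type} [Countable X]
    (H : SimpleGraph X) :
    ∃ φ : X → ℕ, Function.Injective φ ∧ ∀ a b, R.Adj (φ a) (φ b) ↔ H.Adj a b := by
  classical
  suffices h : ∀ H : SimpleGraph ℕ,
      ∃ φ : ℕ → ℕ, Function.Injective φ ∧ ∀ a b, R.Adj (φ a) (φ b) ↔ H.Adj a b by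
    obtain ⟨e⟩ := nonempty_embedding_nat X
    obtain ⟨φ, hφ, hadj⟩ := h (H.map e)
    exact ⟨φ ∘ e, hφ.comp e.injective, fun a b =>
      (hadj (e a) (e b)).trans SimpleGraph.map_adj_apply⟩
  intro H
  have step : ∀ (n : ℕ) (g : ℕ → ℕ), ∃ v, (∀ a < n, ∀ b < n, g a = g b → a = b) →
      ∀ a < n, v ≠ g a ∧ (R.Adj v (g a) ↔ H.Adj n a) := by
    intro n g
    by_cases hg : ∀ a < n, ∀ b < n, g a = g b → a = b
    · obtain ⟨v, hvA, hvB, hA, hB⟩ := hR (((Finset.range n).filter (H.Adj n)).image g)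
        (((Finset.range n).filter fun a => ¬ H.Adj n a).image g) (by
          rw [Finset.disjoint_left]
          intro x hx hx'
          obtain ⟨a, ha, rfl⟩ := Finset.mem_image.1 hx
          obtain ⟨b, hb, hab⟩ := Finset.mem_image.1 hx'
          rw [Finset.mem_filter, Finset.mem_range] at ha hb
          rw [hg b hb.1 a ha.1 hab] at hb
          exact hb.2 ha.2)
      refine ⟨v, fun _ a ha => ?_⟩
      by_cases h : H.Adj n a
      · have hm := Finset.mem_image_of_mem g (Finset.mem_filter.2 ⟨Finset.mem_range.2 ha, h⟩)
        exact ⟨fun hv => hvA (hv ▸ hm), iff_of_true (hA _ hm) h⟩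
      · have hm := Finset.mem_image_of_mem g
          (Finset.mem_filter (p := fun a => ¬ H.Adj n a).2 ⟨Finset.mem_range.2 ha, h⟩)
        exact ⟨fun hv => hvB (hv ▸ hm), iff_of_false (hB _ hm) h⟩
    · exact ⟨0, fun h => absurd h hg⟩
  choose next hnext using step
  let f : ℕ → ℕ → ℕ := fun n =>
    Nat.rec (fun _ => 0) (fun n g => Function.update g n (next n g)) n
  have hsucc : ∀ n, f (n + 1) = Function.update (f n) n (next n (f n)) := fun _ => rfl
  have hf : ∀ n, ∀ a < n, f n a = next a (f a) := by
    intro n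
    induction n with
    | zero => exact fun a ha => absurd ha (Nat.not_lt_zero a)
    | succ n ih =>
      intro a ha
      rw [hsucc]
      rcases Nat.lt_succ_iff_lt_or_eq.1 ha with h | rfl
      · rw [Function.update_of_ne h.ne, ih a h]
      · rw [Function.update_self]
  have hinj : ∀ n, ∀ a < n, ∀ b < n, f n a = f n b → a = b := by
    intro n
    induction n with
    | zero => exact fun a ha => absurd ha (Nat.not_lt_zero a)
    | succ n ih =>
      have h := hnext n (f n) ih
      intro a ha b hb hab
      rw [hsucc] at hab
      rcases Nat.lt_succ_iff_lt_or_eq.1 ha with ha' | rfl <;>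
        rcases Nat.lt_succ_iff_lt_or_eq.1 hb with hb' | hb'
      · rw [Function.update_of_ne ha'.ne, Function.update_of_ne hb'.ne] at hab
        exact ih a ha' b hb' hab
      · subst hb'
        rw [Function.update_of_ne ha'.ne, Function.update_self] at hab
        exact absurd hab.symm (h a ha').1
      · rw [Function.update_of_ne hb'.ne, Function.update_self] at hab
        exact absurd hab (h b hb').1
      · exact hb'.symm
  have key : ∀ n, ∀ a < n, next n (f n) ≠ next a (f a) ∧
      (R.Adj (next n (f n)) (next a (f a)) ↔ H.Adj n a) := by
    intro n a ha
    rw [← hf n a ha]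
    exact hnext n (f n) (hinj n) a ha
  refine ⟨fun n => next n (f n), fun a b hab => ?_, fun a b => ?_⟩
  · rcases lt_trichotomy a b with h | h | h
    · exact absurd hab.symm (key b a h).1
    · exact h
    · exact absurd hab (key a b h).1
  · rcases lt_trichotomy a b with h | rfl | h
    · rw [R.adj_comm, H.adj_comm]
      exact (key b a h).2
    · simp
    · exact (key a b h).2

/-- The vertices of a graph with the extension property can be labelled by words over `{0, 1}`
in such a way that adjacency is given by passing numbers. -/
lemma exists_word_vertices {R : SimpleGraph ℕ} (hR : ExtensionProperty R) :
    ∃ φ : List Bool → ℕ, Function.Injective φ ∧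
      ∀ s t, s.length < t.length → (R.Adj (φ s) (φ t) ↔ t[s.length]? = some true) := by
  obtain ⟨φ, hφ, hadj⟩ := exists_embedding hR
    (SimpleGraph.fromRel fun s t : List Bool => t[s.length]? = some true)
  refine ⟨φ, hφ, fun s t hst => ?_⟩
  rw [hadj, SimpleGraph.fromRel_adj]
  constructor
  · rintro ⟨-, h | h⟩
    · exact h
    · rw [List.getElem?_eq_none hst.le] at h
      simp at h
  · exact fun h => ⟨fun h' => by simp [h'] at hst, Or.inl h⟩

/-- The first occurrence of the value `i`. -/
noncomputable def firstOcc (f : ℕ → ℕ) (i : ℕ) : ℕ :=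
  sInf {x | f x = i}

lemma firstOcc_eq {f : ℕ → ℕ} {x i : ℕ} (h : f x = i) (hlt : ∀ z < x, f z ≠ i) :
    firstOcc f i = x :=
  le_antisymm (Nat.sInf_le h) (not_lt.1 fun h' =>
    hlt _ h' (Nat.sInf_mem (s := {x | f x = i}) ⟨x, h⟩))

lemma IsRigid.apply_firstOcc {f : ℕ → ℕ} (hf : IsRigid f) (i : ℕ) : f (firstOcc f i) = i :=
  Nat.sInf_mem (s := {x | f x = i}) (hf.1 i)

lemma IsRigid.lt_of_lt_firstOcc {f : ℕ → ℕ} (hf : IsRigid f) {i z : ℕ} (hz : z < firstOcc f i) :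
    f z < i := by
  obtain ⟨x, hx, hlt⟩ := hf.exists_first i
  rw [firstOcc_eq hx fun z hz => (hlt z hz).ne] at hz
  exact hlt z hz

lemma IsRigid.firstOcc_strictMono {f : ℕ → ℕ} (hf : IsRigid f) : StrictMono (firstOcc f) := by
  intro i j hij
  by_contra! h
  rcases Nat.lt_or_eq_of_le h with h | h
  · have := hf.lt_of_lt_firstOcc h
    rw [hf.apply_firstOcc] at this
    omega
  · have h1 := hf.apply_firstOcc i
    rw [← h, hf.apply_firstOcc] at h1
    omega

lemma IsRigid.firstOcc_comp {f g : ℕ → ℕ} (hf : IsRigid f) (hg : IsRigid g) (i : ℕ) :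
    firstOcc (f ∘ g) i = firstOcc g (firstOcc f i) := by
  refine firstOcc_eq ?_ fun z hz => ?_
  · rw [Function.comp_apply, hg.apply_firstOcc, hf.apply_firstOcc]
  · exact (hf.lt_of_lt_firstOcc (hg.lt_of_lt_firstOcc hz)).ne

/-- The vertex labelled by the word `b ∘ f`, cut off at the first occurrence of `i` in `f`. -/
noncomputable def wordVertex (φ : List Bool → ℕ) (f : ℕ → ℕ) (i : ℕ) (b : ℕ → Bool) : ℕ :=
  φ ((List.range (firstOcc f i)).map fun x => b (f x))

lemma IsRigid.wordVertex_congr {φ : List Bool → ℕ} {f : ℕ → ℕ} (hf : IsRigid f) {i : ℕ}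
    {b b' : ℕ → Bool} (h : ∀ y < i, b y = b' y) : wordVertex φ f i b = wordVertex φ f i b' := by
  unfold wordVertex
  congr 1
  exact List.map_congr_left fun x hx => h _ (hf.lt_of_lt_firstOcc (List.mem_range.1 hx))

lemma IsRigid.wordVertex_local {φ : List Bool → ℕ} {f g : ℕ → ℕ} (hf : IsRigid f) {m N : ℕ}
    (hN : f N = m) (hfg : ∀ x ≤ N, f x = g x) {i : ℕ} (hi : i ≤ m) (b : ℕ → Bool) :
    wordVertex φ f i b = wordVertex φ g i b := by
  have hle : firstOcc f i ≤ N :=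
    (hf.firstOcc_strictMono.monotone hi).trans (Nat.sInf_le hN)
  have hocc : firstOcc g i = firstOcc f i := by
    refine firstOcc_eq ?_ fun z hz => ?_
    · rw [← hfg _ hle, hf.apply_firstOcc]
    · rw [← hfg z (by omega)]
      exact (hf.lt_of_lt_firstOcc hz).ne
  unfold wordVertex
  rw [hocc]
  congr 1
  refine List.map_congr_left fun x hx => ?_
  rw [hfg x]
  have := List.mem_range.1 hx
  omega

/-- Composing with a suitable `W` makes the pattern of coincidences of the coloring `c` on finite
sets of word vertices independent of the rigid surjection. -/
lemma exists_homogeneous_pattern (φ : List Bool → ℕ) (c : Finset ℕ → ℕ) (m : ℕ) :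
    ∃ W, IsRigid W ∧ ∀ (N₁ N₂ : Finset ℕ) (i : ℕ → ℕ) (b : ℕ → ℕ → Bool),
      (∀ n ∈ N₁ ∪ N₂, i n ≤ m) → ∀ u u', IsRigid u → IsRigid u' →
      c (N₁.image fun n => wordVertex φ (u ∘ W) (i n) (b n)) =
        c (N₂.image fun n => wordVertex φ (u ∘ W) (i n) (b n)) →
      c (N₁.image fun n => wordVertex φ (u' ∘ W) (i n) (b n)) =
        c (N₂.image fun n => wordVertex φ (u' ∘ W) (i n) (b n)) := by
  classical
  let I : Type := Fin (m + 1) × (Fin m → Bool)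
  let ext : (Fin m → Bool) → ℕ → Bool := fun b x => if h : x < m then b ⟨x, h⟩ else false
  let Φ : (ℕ → ℕ) → I → ℕ := fun f p => wordVertex φ f p.1 (ext p.2)
  let χ : (ℕ → ℕ) → (Finset I × Finset I) → Prop :=
    fun f F => c (F.1.image (Φ f)) = c (F.2.image (Φ f))
  have hloc : IsLocal 0 m χ := by
    intro f g hf _ hg _ N hN hfg
    have : Φ f = Φ g := funext fun p =>
      hf.wordVertex_local hN hfg (Nat.le_of_lt_succ p.1.2) _
    simp only [χ, this]
  obtain ⟨W, hW, -, κ, hκ⟩ := hasHomogeneous_zero m _ χ hloc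
  refine ⟨W, hW, fun N₁ N₂ i b hi u u' hu hu' h => ?_⟩
  let p : ℕ → I := fun n => (Fin.ofNat (m + 1) (i n), fun x => b n x)
  have hp : ∀ v, IsRigid v → ∀ N : Finset ℕ, N ⊆ N₁ ∪ N₂ →
      (N.image fun n => wordVertex φ (v ∘ W) (i n) (b n)) = (N.image p).image (Φ (v ∘ W)) := by
    intro v hv N hN
    rw [Finset.image_image]
    refine Finset.image_congr fun n hn => ?_
    have hin := hi n (hN hn)
    have h1 : ((p n).1 : ℕ) = i n := by
      simp [p, Fin.ofNat, Nat.mod_eq_of_lt (Nat.lt_succ_of_le hin)]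
    change _ = wordVertex φ (v ∘ W) ((p n).1 : ℕ) (ext (p n).2)
    rw [h1]
    refine (hv.comp hW).wordVertex_congr fun y hy => ?_
    simp [ext, p, show y < m by omega]
  have hN₁ : N₁ ⊆ N₁ ∪ N₂ := Finset.subset_union_left
  have hN₂ : N₂ ⊆ N₁ ∪ N₂ := Finset.subset_union_right
  rw [hp u hu _ hN₁, hp u hu _ hN₂] at h
  rw [hp u' hu' _ hN₁, hp u' hu' _ hN₂]
  have h1 := hκ u hu fun _ hi => absurd hi (Nat.not_lt_zero _)
  have h2 := hκ u' hu' fun _ hi => absurd hi (Nat.not_lt_zero _)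
  have h3 := congr_fun (h1.trans h2.symm) (N₁.image p, N₂.image p)
  exact h3.mp h

/-! ### Constructing rigid surjections -/

/-- A labelling with infinitely many labels can be turned into a rigid surjection by numbering
the labels in the order of their first occurrences. -/
lemma exists_rigid_of_labelling {D : Type} (g : ℕ → D) (hg : (Set.range g).Infinite) :
    ∃ u, IsRigid u ∧ (∀ x y, u x = u y ↔ g x = g y) ∧
      ∀ (s : Finset D) (x : ℕ), (∀ z < x, g z ∈ s) → u x ≤ s.card := by
  classical
  let c : ℕ → ℕ := fun z => ((Finset.range z).image g).card
  have hsucc : ∀ z, c (z + 1) = if g z ∈ (Finset.range z).image g then c z else c z + 1 := by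
    intro z
    simp only [c, Finset.range_add_one, Finset.image_insert]
    split_ifs with h
    · rw [Finset.insert_eq_of_mem h]
    · rw [Finset.card_insert_of_notMem h]
  have hmono : Monotone c := fun a b hab =>
    Finset.card_le_card (Finset.image_subset_image (Finset.range_subset_range.2 hab))
  have hnew : ∀ y z, y < c z → ∃ w < z, g w ∉ (Finset.range w).image g ∧ c w = y := by
    intro y z
    induction z with
    | zero => exact fun h => absurd h (by simp [c])
    | succ z ih =>
      intro h
      by_cases hz : y < c z
      · obtain ⟨w, hw, h'⟩ := ih hz
        exact ⟨w, by omega, h'⟩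
      · rw [hsucc] at h
        split_ifs at h with hm
        · exact absurd h hz
        · exact ⟨z, by omega, hm, by omega⟩
  let fo : ℕ → ℕ := fun x => Nat.find (⟨x, rfl⟩ : ∃ z, g z = g x)
  have hfo : ∀ x, g (fo x) = g x := fun x => Nat.find_spec (⟨x, rfl⟩ : ∃ z, g z = g x)
  have hfo_le : ∀ x z, g z = g x → fo x ≤ z := fun x z h => Nat.find_min' _ h
  have hfo_new : ∀ x, g (fo x) ∉ (Finset.range (fo x)).image g := by
    intro x h
    obtain ⟨z, hz, hzx⟩ := Finset.mem_image.1 h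
    have := hfo_le x z (hzx.trans (hfo x))
    have := Finset.mem_range.1 hz
    omega
  have hnew_fo : ∀ w, g w ∉ (Finset.range w).image g → fo w = w := by
    intro w hw
    refine le_antisymm (hfo_le w w rfl) (not_lt.1 fun h => hw ?_)
    exact Finset.mem_image.2 ⟨fo w, Finset.mem_range.2 h, hfo w⟩
  refine ⟨fun x => c (fo x), ⟨fun y => ?_, fun x y hy => ?_⟩, fun x y => ⟨fun h => ?_, fun h => ?_⟩,
    fun s x h => ?_⟩
  · obtain ⟨T, hT, hTy⟩ := hg.exists_subset_card_eq (y + 1)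
    rw [← Set.image_univ, Finset.subset_set_image_iff] at hT
    obtain ⟨S, -, rfl⟩ := hT
    have hS : S ⊆ Finset.range (S.sup id + 1) := fun z hz =>
      Finset.mem_range.2 (Nat.lt_succ_of_le (Finset.le_sup (f := id) hz))
    have hlt : y < c (S.sup id + 1) := by
      have : (S.image g).card ≤ c (S.sup id + 1) :=
        Finset.card_le_card (Finset.image_subset_image hS)
      omega
    obtain ⟨w, -, hw, rfl⟩ := hnew y _ hlt
    exact ⟨w, by simp only [hnew_fo w hw]⟩
  · obtain ⟨w, hw, hwn, rfl⟩ := hnew y _ hy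
    exact ⟨w, hw.trans_le (hfo_le x x rfl), by simp only [hnew_fo w hwn]⟩
  · have hlt : ∀ a b, fo a < fo b → c (fo a) < c (fo b) := by
      intro a b hab
      have h1 := hsucc (fo a)
      rw [if_neg (hfo_new a)] at h1
      have := hmono (Nat.succ_le_of_lt hab)
      rw [Nat.succ_eq_add_one] at this
      omega
    have h' : fo x = fo y := by
      rcases lt_trichotomy (fo x) (fo y) with h1 | h1 | h1
      · exact absurd h (hlt x y h1).ne
      · exact h1
      · exact absurd h (hlt y x h1).ne'
    rw [← hfo x, ← hfo y, h']
  · have : fo x = fo y := le_antisymm (hfo_le x _ ((hfo y).trans h.symm))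
      (hfo_le y _ ((hfo x).trans h))
    simp only [this]
  · refine Finset.card_le_card fun d hd => ?_
    obtain ⟨z, hz, rfl⟩ := Finset.mem_image.1 hd
    exact h z ((Finset.mem_range.1 hz).trans_le (hfo_le x x rfl))

/-- For blocks of length `K ≥ 2`, there is a rigid surjection which has first occurrences at the
second element of the blocks of `n ∈ N`, is constant on the rest of these blocks, and through
which the given functions `b n`, as functions of the block, factor in front of these first
occurrences. -/
lemma exists_rigid_blocks {K : ℕ} (hK : 2 ≤ K) (N : Finset ℕ) (b : ℕ → ℕ → Bool) :
    ∃ (u : ℕ → ℕ) (β : ℕ → ℕ → Bool), IsRigid u ∧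
      (∀ n ∈ N, u (K * n + 1) ≤ 4 ^ N.card) ∧
      (∀ n ∈ N, ∀ z < K * n + 1, u z < u (K * n + 1)) ∧
      (∀ n ∈ N, ∀ z < K * n + 1, β n (u z) = b n (z / K)) ∧
      ∀ n ∈ N, ∀ j, 1 ≤ j → j < K → u (K * n + j) = u (K * n + 1) := by
  classical
  let B := K * (N.sup id + 1)
  have hB : ∀ n ∈ N, ∀ j < K, K * n + j < B := by
    intro n hn j hj
    have h1 : n ≤ N.sup id := Finset.le_sup (f := id) hn
    have h2 : K * (n + 1) ≤ B := Nat.mul_le_mul_left K (by omega)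
    rw [Nat.mul_add_one] at h2
    omega
  let l : ℕ → Finset ℕ × Finset ℕ := fun x =>
    (N.filter fun n => K * n + 1 ≤ x, N.filter fun n => b n (x / K) = true)
  let g : ℕ → (Finset ℕ × Finset ℕ) ⊕ ℕ := fun x => if x < B then Sum.inl (l x) else Sum.inr x
  have hgl : ∀ x < B, g x = Sum.inl (l x) := fun x hx => if_pos hx
  have hg : (Set.range g).Infinite := by
    refine Set.infinite_of_injective_forall_mem (f := fun i : ℕ => g (B + i)) ?_
      fun i => Set.mem_range_self _
    intro i j hij
    simpa [g] using hij
  obtain ⟨u, hu, hug, hcard⟩ := exists_rigid_of_labelling g hg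
  have hne : ∀ n ∈ N, ∀ z < K * n + 1, u z ≠ u (K * n + 1) := by
    intro n hn z hz h
    have hn' := hB n hn 1 (by omega)
    rw [hug, hgl z (by omega), hgl _ hn'] at h
    have h1 : n ∈ (l z).1 := by
      rw [Sum.inl.inj h]
      exact Finset.mem_filter.2 ⟨hn, le_rfl⟩
    have := (Finset.mem_filter.1 h1).2
    omega
  refine ⟨u, fun n y => decide (∃ x < K * n + 1, u x = y ∧ b n (x / K) = true), hu,
    fun n hn => ?_, fun n hn z hz => ?_, fun n hn z hz => ?_, fun n hn j hj hjK => ?_⟩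
  · have := hcard ((N.powerset ×ˢ N.powerset).map Function.Embedding.inl) (K * n + 1) (by
      intro z hz
      rw [hgl z (by have := hB n hn 1 (by omega); omega)]
      simp [l])
    rw [Finset.card_map, Finset.card_product, Finset.card_powerset, ← mul_pow] at this
    exact this
  · refine lt_of_le_of_ne (not_lt.1 fun h => ?_) (hne n hn z hz)
    obtain ⟨w, hw, h'⟩ := hu.2 _ _ h
    exact hne n hn w (by omega) h'
  · have hn' := hB n hn 1 (by omega)
    rw [Bool.eq_iff_iff, decide_eq_true_iff]
    constructor
    · rintro ⟨x, hx, hxz, hb⟩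
      rw [hug, hgl x (by omega), hgl z (by omega)] at hxz
      have h1 : n ∈ (l z).2 := by
        rw [← Sum.inl.inj hxz]
        exact Finset.mem_filter.2 ⟨hn, hb⟩
      exact (Finset.mem_filter.1 h1).2
    · exact fun h => ⟨z, hz, rfl, h⟩
  · rw [hug, hgl _ (hB n hn j hjK), hgl _ (hB n hn 1 (by omega))]
    congr 1
    refine Prod.ext (Finset.filter_congr fun n' _ => ?_) ?_
    · rcases Nat.lt_or_ge n n' with h | h
      · have : K * (n + 1) ≤ K * n' := Nat.mul_le_mul_left K h
        rw [Nat.mul_add_one] at this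
        omega
      · have : K * n' ≤ K * n := Nat.mul_le_mul_left K h
        omega
    · simp only [l]
      rw [Nat.mul_add_div (by omega), Nat.mul_add_div (by omega), Nat.div_eq_of_lt hjK,
        Nat.div_eq_of_lt (by omega : 1 < K)]

/-- Shifting the position of a first occurrence inside a block: the block of `n₀` is mapped to
`K * n₀` in front of `K * n₀ + t`, and to `K * n₀ + 1` from there on. -/
def blockShift (K n₀ t x : ℕ) : ℕ :=
  if x / K = n₀ then if x < K * n₀ + t then K * n₀ else K * n₀ + 1 else x

lemma blockShift_of_ne {K n₀ t x : ℕ} (h : x / K ≠ n₀) : blockShift K n₀ t x = x :=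
  if_neg h

lemma blockShift_of_lt {K n₀ t j : ℕ} (hj : j < t) (htK : t < K) :
    blockShift K n₀ t (K * n₀ + j) = K * n₀ := by
  have : (K * n₀ + j) / K = n₀ := by
    rw [Nat.mul_add_div (by omega), Nat.div_eq_of_lt (by omega), add_zero]
  rw [blockShift, if_pos this, if_pos (by omega)]

lemma blockShift_of_ge {K n₀ t j : ℕ} (hj : t ≤ j) (hjK : j < K) :
    blockShift K n₀ t (K * n₀ + j) = K * n₀ + 1 := by
  have : (K * n₀ + j) / K = n₀ := by
    rw [Nat.mul_add_div (by omega), Nat.div_eq_of_lt (by omega), add_zero]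
  rw [blockShift, if_pos this, if_neg (by omega)]

lemma exists_eq_mul_add_of_div_eq {K n₀ x : ℕ} (hK : 0 < K) (h : x / K = n₀) :
    ∃ j < K, x = K * n₀ + j :=
  ⟨x % K, Nat.mod_lt _ hK, by rw [← h, Nat.div_add_mod]⟩

lemma blockShift_le {K n₀ t : ℕ} (ht : 1 ≤ t) (htK : t < K) (x : ℕ) :
    blockShift K n₀ t x ≤ x := by
  by_cases h : x / K = n₀
  · obtain ⟨j, hj, rfl⟩ := exists_eq_mul_add_of_div_eq (by omega) h
    rcases Nat.lt_or_ge j t with hjt | hjt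
    · rw [blockShift_of_lt hjt htK]
      omega
    · rw [blockShift_of_ge hjt hj]
      omega
  · exact (blockShift_of_ne h).le

lemma blockShift_div {K n₀ t : ℕ} (hK : 2 ≤ K) (x : ℕ) : blockShift K n₀ t x / K = x / K := by
  by_cases h : x / K = n₀
  · rw [blockShift, if_pos h, h]
    split_ifs
    · exact Nat.mul_div_cancel_left _ (by omega)
    · rw [Nat.mul_add_div (by omega), Nat.div_eq_of_lt (by omega : 1 < K), add_zero]
  · rw [blockShift_of_ne h]

lemma IsRigid.comp_blockShift {u : ℕ → ℕ} (hu : IsRigid u) {K n₀ t : ℕ} (ht : 1 ≤ t)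
    (htK : t < K) (hconst : ∀ j, 1 ≤ j → j < K → u (K * n₀ + j) = u (K * n₀ + 1)) :
    IsRigid (u ∘ blockShift K n₀ t) := by
  have hval : ∀ z, (u ∘ blockShift K n₀ t) z = u z ∨
      (∃ j, 1 ≤ j ∧ j < K ∧ z = K * n₀ + j) ∧ (u ∘ blockShift K n₀ t) (K * n₀ + t) = u z := by
    intro z
    by_cases h : z / K = n₀
    · obtain ⟨j, hj, rfl⟩ := exists_eq_mul_add_of_div_eq (by omega) h
      rcases Nat.eq_zero_or_pos j with rfl | hj0
      · left
        rw [Function.comp_apply, blockShift_of_lt ht htK, add_zero]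
      · right
        refine ⟨⟨j, hj0, hj, rfl⟩, ?_⟩
        rw [Function.comp_apply, blockShift_of_ge le_rfl htK, hconst j hj0 hj]
    · left
      rw [Function.comp_apply, blockShift_of_ne h]
  refine ⟨fun y => ?_, fun x y hy => ?_⟩
  · obtain ⟨x, rfl⟩ := hu.1 y
    rcases hval x with h | ⟨-, h⟩
    · exact ⟨x, h⟩
    · exact ⟨_, h⟩
  · obtain ⟨z, hz, rfl⟩ := hu.2 _ _ hy
    have hx := blockShift_le (n₀ := n₀) ht htK x
    rcases hval z with h | ⟨⟨j, hj, hjK, rfl⟩, h⟩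
    · exact ⟨z, by omega, h⟩
    · refine ⟨_, ?_, h⟩
      by_cases hxn : x / K = n₀
      · obtain ⟨i, hi, rfl⟩ := exists_eq_mul_add_of_div_eq (by omega) hxn
        rcases Nat.lt_or_ge i t with hit | hit
        · rw [blockShift_of_lt hit htK] at hz
          omega
        · rw [blockShift_of_ge hit hi] at hz
          omega
      · by_contra! hlt
        rw [blockShift_of_ne hxn] at hz
        refine hxn ?_
        rw [Nat.div_eq_iff (by omega)]
        rw [Nat.mul_comm] at hz hlt
        omega

/-! ### Copies of the Rado graph -/

/-- The vertex labelled by the adjacencies of `n`, spread over blocks of length `K` and along `W`,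
and cut off at the `t`-th position of the block of `n`. -/
noncomputable def blockVertex (φ : List Bool → ℕ) (b : ℕ → ℕ → Bool) (K : ℕ) (W : ℕ → ℕ)
    (n t : ℕ) : ℕ :=
  φ ((List.range (firstOcc W (K * n + t))).map fun x => b n (W x / K))

lemma blockVertex_injective {φ : List Bool → ℕ} (hφ : Function.Injective φ) {b : ℕ → ℕ → Bool}
    {K : ℕ} {W : ℕ → ℕ} (hW : IsRigid W) {n t n' t' : ℕ} (ht : t < K) (ht' : t' < K)
    (h : blockVertex φ b K W n t = blockVertex φ b K W n' t') : n = n' ∧ t = t' := by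
  have h1 := congr_arg List.length (hφ h)
  simp only [List.length_map, List.length_range] at h1
  have h2 := hW.firstOcc_strictMono.injective h1
  have h3 : n = n' := by
    have := congr_arg (· / K) h2
    simpa [Nat.mul_add_div (show 0 < K by omega), Nat.div_eq_of_lt ht,
      Nat.div_eq_of_lt ht'] using this
  subst h3
  exact ⟨rfl, by omega⟩

lemma blockVertex_adj {R : SimpleGraph ℕ} {φ : List Bool → ℕ}
    (hadj : ∀ s t, s.length < t.length → (R.Adj (φ s) (φ t) ↔ t[s.length]? = some true))
    {b : ℕ → ℕ → Bool} (hb : ∀ n n', b n n' = true ↔ R.Adj n n') {K : ℕ} {W : ℕ → ℕ}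
    (hW : IsRigid W) {τ : ℕ → ℕ} (hτ : ∀ n, τ n < K) (n n' : ℕ) :
    R.Adj (blockVertex φ b K W n (τ n)) (blockVertex φ b K W n' (τ n')) ↔ R.Adj n n' := by
  have key : ∀ n n', n < n' →
      (R.Adj (blockVertex φ b K W n (τ n)) (blockVertex φ b K W n' (τ n')) ↔ R.Adj n n') := by
    intro n n' h
    have h1 : K * (n + 1) ≤ K * n' := Nat.mul_le_mul_left K h
    rw [Nat.mul_add_one] at h1
    have := hτ n
    have h2 : firstOcc W (K * n + τ n) < firstOcc W (K * n' + τ n') :=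
      hW.firstOcc_strictMono (by omega)
    rw [blockVertex, blockVertex, hadj _ _ (by simpa using h2)]
    simp only [List.length_map, List.length_range, List.getElem?_map,
      List.getElem?_range h2, Option.map_some, Option.some.injEq]
    rw [hW.apply_firstOcc, Nat.mul_add_div (by omega), Nat.div_eq_of_lt (hτ n), add_zero, hb,
      R.adj_comm]
  rcases lt_trichotomy n n' with h | rfl | h
  · exact key n n' h
  · simp
  · rw [R.adj_comm, key n' n h, R.adj_comm]

/-- Moving one vertex of the first of two finite sets inside its block does not affect whether
their colors coincide. -/
lemma exists_shift_invariant (φ : List Bool → ℕ) (b : ℕ → ℕ → Bool) (c : Finset ℕ → ℕ) {K : ℕ}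
    (hK : 2 ≤ K) (g : ℕ) :
    ∃ W, IsRigid W ∧ ∀ (N₁ N₂ : Finset ℕ) (n₀ : ℕ), n₀ ∈ N₁ → (N₁ ∪ N₂).card ≤ g →
      ∀ t t', 1 ≤ t → t < K → 1 ≤ t' → t' < K →
      c (N₁.image fun n => blockVertex φ b K W n (if n = n₀ then t else 1)) =
        c (N₂.image fun n => blockVertex φ b K W n (if n = n₀ then t else 1)) →
      c (N₁.image fun n => blockVertex φ b K W n (if n = n₀ then t' else 1)) =
        c (N₂.image fun n => blockVertex φ b K W n (if n = n₀ then t' else 1)) := by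
  obtain ⟨W, hW, hhom⟩ := exists_homogeneous_pattern φ c (4 ^ g)
  refine ⟨W, hW, fun N₁ N₂ n₀ hn₀ hcard t t' ht htK ht' ht'K => ?_⟩
  obtain ⟨u, β, hu, hle, hfirst, hβ, hconst⟩ := exists_rigid_blocks hK (N₁ ∪ N₂) b
  have hn₀' : n₀ ∈ N₁ ∪ N₂ := Finset.mem_union_left _ hn₀
  have hrigid : ∀ t, 1 ≤ t → t < K → IsRigid (u ∘ blockShift K n₀ t) := fun t ht htK =>
    hu.comp_blockShift ht htK (hconst n₀ hn₀')
  have hvertex : ∀ t, 1 ≤ t → t < K → ∀ n ∈ N₁ ∪ N₂,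
      wordVertex φ ((u ∘ blockShift K n₀ t) ∘ W) (u (K * n + 1)) (β n) =
        blockVertex φ b K W n (if n = n₀ then t else 1) := by
    intro t ht htK n hn
    set j := if n = n₀ then t else 1 with hj
    have hmid : ∀ z < K * n + j, blockShift K n₀ t z < K * n + 1 := by
      intro z hz
      by_cases h : n = n₀
      · subst h
        rw [if_pos rfl] at hj
        by_cases hzn : z / K = n
        · obtain ⟨i, hi, rfl⟩ := exists_eq_mul_add_of_div_eq (by omega) hzn
          rw [blockShift_of_lt (by omega) htK]
          omega
        · rw [blockShift_of_ne hzn]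
          by_contra! hlt
          refine hzn ?_
          rw [Nat.div_eq_iff (by omega)]
          rw [Nat.mul_comm] at hz hlt
          omega
      · rw [if_neg h] at hj
        exact (blockShift_le ht htK z).trans_lt (by omega)
    have hend : (u ∘ blockShift K n₀ t) (K * n + j) = u (K * n + 1) := by
      by_cases h : n = n₀
      · subst h
        rw [hj, if_pos rfl, Function.comp_apply, blockShift_of_ge le_rfl htK]
      · rw [hj, if_neg h, Function.comp_apply, blockShift_of_ne]
        rw [Nat.mul_add_div (by omega), Nat.div_eq_of_lt (by omega : 1 < K)]
        simpa using h
    have hocc : firstOcc (u ∘ blockShift K n₀ t) (u (K * n + 1)) = K * n + j :=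
      firstOcc_eq hend fun z hz => (hfirst n hn _ (hmid z hz)).ne
    unfold wordVertex blockVertex
    rw [(hrigid t ht htK).firstOcc_comp hW, hocc]
    congr 1
    refine List.map_congr_left fun x hx => ?_
    have hx' := hW.lt_of_lt_firstOcc (List.mem_range.1 hx)
    simp only [Function.comp_apply]
    rw [hβ n hn _ (hmid _ hx'), blockShift_div hK]
  have himage : ∀ t, 1 ≤ t → t < K → ∀ N ⊆ N₁ ∪ N₂,
      (N.image fun n => blockVertex φ b K W n (if n = n₀ then t else 1)) =
        N.image fun n =>
          wordVertex φ ((u ∘ blockShift K n₀ t) ∘ W) (u (K * n + 1)) (β n) :=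
    fun t ht htK N hN => Finset.image_congr fun n hn => (hvertex t ht htK n (hN hn)).symm
  rw [himage t ht htK N₁ Finset.subset_union_left, himage t ht htK N₂ Finset.subset_union_right,
    himage t' ht' ht'K N₁ Finset.subset_union_left,
    himage t' ht' ht'K N₂ Finset.subset_union_right]
  exact hhom N₁ N₂ (fun n => u (K * n + 1)) β
    (fun n hn => (hle n hn).trans (Nat.pow_le_pow_right (by omega) hcard)) _ _
    (hrigid t ht htK) (hrigid t' ht' ht'K)

lemma extensionPropertyOn_range {R : SimpleGraph ℕ} (hR : ExtensionProperty R) {θ : ℕ → ℕ}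
    (hinj : Function.Injective θ) (hθ : ∀ a b, R.Adj (θ a) (θ b) ↔ R.Adj a b) :
    ExtensionPropertyOn R (Set.range θ) := by
  intro A B hA hB hAB
  rw [← Set.image_univ, Finset.subset_set_image_iff] at hA hB
  obtain ⟨A, -, rfl⟩ := hA
  obtain ⟨B, -, rfl⟩ := hB
  rw [Finset.disjoint_image hinj] at hAB
  obtain ⟨v, hvA, hvB, h1, h2⟩ := hR A B hAB
  refine ⟨θ v, ⟨v, rfl⟩, ?_, ?_, ?_, ?_⟩
  · rwa [hinj.mem_finset_image]
  · rwa [hinj.mem_finset_image]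
  · intro x hx
    obtain ⟨a, ha, rfl⟩ := Finset.mem_image.1 hx
    exact (hθ v a).2 (h1 a ha)
  · intro x hx
    obtain ⟨a, ha, rfl⟩ := Finset.mem_image.1 hx
    exact fun h => h2 a ha ((hθ v a).1 h)

lemma isInducedCopy_image_iff {V : Type} [Fintype V] {G : SimpleGraph V} {R : SimpleGraph ℕ}
    {θ : ℕ → ℕ} (hinj : Function.Injective θ) (hθ : ∀ a b, R.Adj (θ a) (θ b) ↔ R.Adj a b)
    {N : Finset ℕ} : IsInducedCopy G R (N.image θ) ↔ IsInducedCopy G R N := by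
  constructor
  · rintro ⟨f, hf, hadj, him⟩
    have hex : ∀ v, ∃ n, θ n = f v := by
      intro v
      have : f v ∈ N.image θ := him ▸ Finset.mem_image_of_mem f (Finset.mem_univ v)
      obtain ⟨n, -, hn⟩ := Finset.mem_image.1 this
      exact ⟨n, hn⟩
    choose f' hf' using hex
    refine ⟨f', fun a b hab => hf (by rw [← hf', ← hf', hab]), fun a b => ?_, ?_⟩
    · rw [hadj, ← hf' a, ← hf' b, hθ]
    · refine Finset.image_injective hinj ?_
      rw [← him, Finset.image_image]
      exact Finset.image_congr fun v _ => hf' v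
  · rintro ⟨f, hf, hadj, rfl⟩
    exact ⟨θ ∘ f, hinj.comp hf, fun a b => (hadj a b).trans (hθ _ _).symm,
      Finset.image_image.symm⟩

lemma IsInducedCopy.card_eq {V : Type} [Fintype V] {G : SimpleGraph V} {R : SimpleGraph ℕ}
    {N : Finset ℕ} (h : IsInducedCopy G R N) : N.card = Fintype.card V := by
  obtain ⟨f, hf, -, rfl⟩ := h
  rw [Finset.card_image_of_injective _ hf, Finset.card_univ]

end RadoRainbow

open RadoRainbow

/-- The Rado graph has the rainbow Ramsey property for `k`-bounded colorings: for any
coloring of the induced copies of a finite graph `G` in a Rado graph `R` with values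
in `ℕ`, in which each color is used at most `k ≥ 2` times, there is an induced Rado
subgraph of `R` in which no two distinct copies of `G` receive the same color. -/
theorem rado_rainbow_ramsey {V : Type} [Fintype V] (G : SimpleGraph V)
    (k : ℕ) (hk : 2 ≤ k) (R : SimpleGraph ℕ) (hR : ExtensionProperty R)
    (c : Finset ℕ → ℕ)
    (hbd : ∀ n : ℕ, {F : Finset ℕ | IsInducedCopy G R F ∧ c F = n}.Finite ∧
      {F : Finset ℕ | IsInducedCopy G R F ∧ c F = n}.ncard ≤ k) :
    ∃ S : Set ℕ, ExtensionPropertyOn R S ∧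
      ∀ F₁ F₂ : Finset ℕ, IsInducedCopy G R F₁ → IsInducedCopy G R F₂ →
        ↑F₁ ⊆ S → ↑F₂ ⊆ S → c F₁ = c F₂ → F₁ = F₂ := by
  obtain ⟨φ, hφ, hadj⟩ := exists_word_vertices hR
  classical
  let b : ℕ → ℕ → Bool := fun n n' => decide (R.Adj n n')
  have hb : ∀ n n', b n n' = true ↔ R.Adj n n' := fun n n' => decide_eq_true_iff
  obtain ⟨W, hW, hinv⟩ := exists_shift_invariant φ b c (K := k + 2) (by omega)
    (2 * Fintype.card V)
  let θ : (ℕ → ℕ) → ℕ → ℕ := fun τ n => blockVertex φ b (k + 2) W n (τ n)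
  have hθ : ∀ τ : ℕ → ℕ, (∀ n, τ n < k + 2) →
      Function.Injective (θ τ) ∧ ∀ n n', R.Adj (θ τ n) (θ τ n') ↔ R.Adj n n' := fun τ hτ =>
    ⟨fun n n' h => (blockVertex_injective hφ hW (hτ n) (hτ n') h).1,
      blockVertex_adj hadj hb hW hτ⟩
  have hθ₁ := hθ (fun _ => 1) fun _ => by omega
  refine ⟨Set.range (θ fun _ => 1), extensionPropertyOn_range hR hθ₁.1 hθ₁.2, ?_⟩
  intro F₁ F₂ hF₁ hF₂ hS₁ hS₂ hc
  by_contra hne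
  rw [← Set.image_univ, Finset.subset_set_image_iff] at hS₁ hS₂
  obtain ⟨N₁, -, rfl⟩ := hS₁
  obtain ⟨N₂, -, rfl⟩ := hS₂
  have hN₁ := (isInducedCopy_image_iff hθ₁.1 hθ₁.2).1 hF₁
  have hN₂ := (isInducedCopy_image_iff hθ₁.1 hθ₁.2).1 hF₂
  have hcard₁ := RadoRainbow.IsInducedCopy.card_eq hN₁
  have hcard₂ := RadoRainbow.IsInducedCopy.card_eq hN₂
  obtain ⟨n₀, hn₀, hn₀'⟩ : ∃ n₀ ∈ N₁, n₀ ∉ N₂ := by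
    by_contra! h
    exact hne (by rw [Finset.eq_of_subset_of_card_le h (by omega)])
  let τ : ℕ → ℕ → ℕ := fun t n => if n = n₀ then t else 1
  have hτ : ∀ t < k + 2, ∀ n, τ t n < k + 2 := by
    intro t ht n
    simp only [τ]
    split_ifs <;> omega
  have hτ₁ : τ 1 = fun _ => 1 := funext fun n => ite_self 1
  have hfix : ∀ t, N₂.image (θ (τ t)) = N₂.image (θ fun _ => 1) := by
    intro t
    refine Finset.image_congr fun n hn => ?_
    have : n ≠ n₀ := fun h => hn₀' (h ▸ hn)
    simp [θ, τ, this]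
  have hcol : ∀ t, 1 ≤ t → t < k + 2 →
      c (N₁.image (θ (τ t))) = c (N₂.image (θ fun _ => 1)) := by
    intro t ht htk
    rw [← hfix t]
    refine hinv N₁ N₂ n₀ hn₀ ?_ 1 t le_rfl (by omega) ht htk ?_
    · have := Finset.card_union_le N₁ N₂
      omega
    · change c (N₁.image (θ (τ 1))) = c (N₂.image (θ (τ 1)))
      rw [hτ₁]
      exact hc
  obtain ⟨hfin, hncard⟩ := hbd (c (N₂.image (θ fun _ => 1)))
  have hsub : (((Finset.Icc 1 (k + 1)).image fun t => N₁.image (θ (τ t)) :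
      Finset (Finset ℕ)) : Set (Finset ℕ)) ⊆
      {F | IsInducedCopy G R F ∧ c F = c (N₂.image (θ fun _ => 1))} := by
    intro F hF
    obtain ⟨t, ht, rfl⟩ := Finset.mem_image.1 (Finset.mem_coe.1 hF)
    rw [Finset.mem_Icc] at ht
    have h := hθ (τ t) (hτ t (by omega))
    exact ⟨(isInducedCopy_image_iff h.1 h.2).2 hN₁, hcol t ht.1 (by omega)⟩
  have hle := Set.ncard_le_ncard hsub hfin
  rw [Set.ncard_coe_finset, Finset.card_image_of_injOn, Nat.card_Icc] at hle
  · omega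
  · intro t ht t' ht' h
    rw [Finset.mem_coe, Finset.mem_Icc] at ht ht'
    have hmem : θ (τ t) n₀ ∈ N₁.image (θ (τ t')) := by
      rw [← show N₁.image (θ (τ t)) = N₁.image (θ (τ t')) from h]
      exact Finset.mem_image_of_mem _ hn₀
    obtain ⟨n, -, hn⟩ := Finset.mem_image.1 hmem
    obtain ⟨rfl, h'⟩ := blockVertex_injective hφ hW (hτ t' (by omega) n)
      (hτ t (by omega) n₀) hn
    simpa [τ] using h'.symm
end

section
/- Milliken's theorem for strong trees (binary case): for every k ≥ 1, every r ≥ 1, and every coloring c of the set of all strong subtrees of 2^{<ω} of height k into r colors, there exists an infinite strong subtree S of 2^{<ω} (with some infinite level set A ⊆ ℕ) such that all strong subtrees of height k whose nodes lie in S and whose levels lie in A receive the same color under c. -/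
/-- `S ⊆ 2^{<ω}` (nodes coded as `List Bool`, ordered by end-extension, i.e. the
prefix order) is a strong subtree of the binary tree with level set `A ⊆ ℕ`:
(i) every node of `S` has length in `A`, and every length in `A` is realized in `S`;
(ii) `S` has a unique node of minimal length (the stem);
(iii) for every `s ∈ S` and every `a' ∈ A` which is the least element of `A` greater
than `|s|`, and each direction `i : Bool`, there is exactly one node of `S` of length
`a'` end-extending `s ++ [i]`;
(iv) every non-minimal node of `S` arises this way: it end-extends `s ++ [i]` for
some `s ∈ S` with no level of `A` strictly between `|s|` and its own length. -/
def IsStrongSubtree (S : Set (List Bool)) (A : Set ℕ) : Prop :=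
  (∀ s ∈ S, s.length ∈ A) ∧
  (∀ a ∈ A, ∃ s ∈ S, s.length = a) ∧
  (∃! s, s ∈ S ∧ ∀ t ∈ S, s.length ≤ t.length) ∧
  (∀ s ∈ S, ∀ a' ∈ A, s.length < a' → (∀ b ∈ A, s.length < b → a' ≤ b) →
    ∀ i : Bool, ∃! t, t ∈ S ∧ t.length = a' ∧ (s ++ [i]) <+: t) ∧
  (∀ t ∈ S, (∃ u ∈ S, u.length < t.length) →
    ∃ s ∈ S, ∃ i : Bool, (s ++ [i]) <+: t ∧ s.length < t.length ∧
      ∀ b ∈ A, s.length < b → t.length ≤ b)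

section Ultrafilters

attribute [local instance] Ultrafilter.mul Ultrafilter.semigroup

/-- A compact right topological semigroup contains an idempotent which is minimal among the
idempotents. -/
theorem exists_minimal_idempotent {M : Type*} [Nonempty M] [Semigroup M] [TopologicalSpace M]
    [CompactSpace M] [T2Space M] (hc : ∀ r : M, Continuous (· * r)) :
    ∃ w : M, w * w = w ∧ ∀ e : M, e * e = e → w * e = e → e * w = e → e = w := by
  let I : Set (Set M) := {N | IsClosed N ∧ N.Nonempty ∧ ∀ x : M, ∀ y ∈ N, x * y ∈ N}
  obtain ⟨L, hL⟩ : ∃ L, Minimal (· ∈ I) L := by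
    refine zorn_superset _ fun C hC hchain => ⟨⋂₀ C, ⟨isClosed_sInter fun t ht => (hC ht).1, ?_,
      fun x y hy t ht => (hC ht).2.2 x y (hy t ht)⟩, fun s hs => Set.sInter_subset_of_mem hs⟩
    obtain rfl | hne := C.eq_empty_or_nonempty
    · rw [Set.sInter_empty]
      exact Set.univ_nonempty
    · exact IsCompact.nonempty_sInter_of_directed_nonempty_isCompact_isClosed (hS := hne.to_subtype)
        (IsChain.directedOn hchain.symm) (fun s hs => (hC hs).2.1)
        (fun s hs => (hC hs).1.isCompact) (fun s hs => (hC hs).1)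
  obtain ⟨hLc, hLn, hLm⟩ := hL.prop
  obtain ⟨w, hwL, hw⟩ := exists_idempotent_in_compact_subsemigroup hc L hLn hLc.isCompact
    fun x _ y hy => hLm x y hy
  refine ⟨w, hw, fun e he hwe hew => ?_⟩
  have heL : e ∈ L := hew ▸ hLm e w hwL
  have hrange : Set.range (· * e) = L := by
    refine hL.eq_of_subset ⟨(isCompact_range (hc e)).isClosed, ⟨_, ⟨e, rfl⟩⟩, ?_⟩ ?_
    · rintro x _ ⟨y, rfl⟩
      exact ⟨x * y, mul_assoc _ _ _⟩
    · rintro _ ⟨y, rfl⟩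
      exact hLm y e heL
  obtain ⟨y, hy⟩ := hrange.symm ▸ hwL
  rw [← hwe, ← hy]
  simp only [mul_assoc, he]

theorem Ultrafilter.map_mulHom_mul {M N : Type*} [Mul M] [Mul N] (f : M →ₙ* N) (U V : Ultrafilter M) :
    (U * V).map f = U.map f * V.map f :=
  Ultrafilter.coe_inj.mp <| Filter.ext' fun p => by
    simp [Ultrafilter.eventually_mul]

/-- The ultrafilter form of the Hales–Jewett theorem: given retractions `σ a` of a semigroup `T`
onto a semigroup `S` and a two-sided ideal `V` of `T`, there is an ultrafilter on `V` whose images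
under all the `σ a` are one and the same idempotent. -/
theorem exists_ultrafilter_map_eq {S T α : Type*} [Semigroup S] [Semigroup T] [Nonempty S]
    (ι : S →ₙ* T) (σ : α → T →ₙ* S) (hσ : ∀ a s, σ a (ι s) = s) (V : Set T)
    (hV : V.Nonempty) (hl : ∀ x, ∀ y ∈ V, x * y ∈ V) (hr : ∀ x, ∀ y ∈ V, y * x ∈ V) :
    ∃ (w : Ultrafilter S) (v : Ultrafilter T), w * w = w ∧ V ∈ v ∧ ∀ a, v.map (σ a) = w := by
  obtain ⟨w, hw, hmin⟩ := exists_minimal_idempotent (M := Ultrafilter S)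
    Ultrafilter.continuous_mul_left
  set w' : Ultrafilter T := w.map ι with hw'
  have hw'w : w' * w' = w' := by rw [hw', ← Ultrafilter.map_mulHom_mul, hw]
  have hσw : ∀ a, w'.map (σ a) = w := fun a => by
    rw [hw', Ultrafilter.map_map]
    have : (σ a ∘ ι : S → S) = id := funext (hσ a)
    rw [this, Ultrafilter.map_id]
  let β : Set (Ultrafilter T) := {U | V ∈ U}
  have hβl : ∀ x, ∀ y ∈ β, x * y ∈ β := fun x y hy =>
    (Ultrafilter.eventually_mul x y (· ∈ V)).2 <| Filter.Eventually.of_forall fun m =>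
      Filter.mem_of_superset hy fun m' hm' => hl m m' hm'
  have hβr : ∀ x, ∀ y ∈ β, y * x ∈ β := fun x y hy =>
    (Ultrafilter.eventually_mul y x (· ∈ V)).2 <| Filter.mem_of_superset hy fun m hm =>
      Filter.Eventually.of_forall fun m' => hr m' m hm
  obtain ⟨t, ht⟩ := hV
  obtain ⟨e, ⟨x, hx, rfl⟩, he⟩ := exists_idempotent_in_compact_subsemigroup
    Ultrafilter.continuous_mul_left ((· * w') '' β)
    ⟨_, pure t, show V ∈ (pure t : Ultrafilter T) from ht, rfl⟩
    ((ultrafilter_isClosed_basic V).isCompact.image (Ultrafilter.continuous_mul_left w')) (by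
      rintro _ ⟨x, hx, rfl⟩ _ ⟨y, hy, rfl⟩
      exact ⟨x * w' * y, hβl _ _ hy, mul_assoc _ _ _⟩)
  simp only at he
  have hidem : w' * (x * w') * (w' * (x * w')) = w' * (x * w') := by
    calc w' * (x * w') * (w' * (x * w')) = w' * ((x * (w' * w')) * (x * w')) := by
          simp only [mul_assoc]
      _ = w' * (x * w') := by rw [hw'w, he]
  refine ⟨w, w' * (x * w'), hw, (show w' * (x * w') ∈ β from hβl _ _ (hβr _ _ hx)),
    fun a => hmin _ ?_ ?_ ?_⟩
  · rw [← Ultrafilter.map_mulHom_mul, hidem]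
  · conv_lhs => rw [← hσw a]
    rw [← Ultrafilter.map_mulHom_mul, ← mul_assoc, hw'w]
  · conv_lhs => rw [← hσw a]
    rw [← Ultrafilter.map_mulHom_mul, mul_assoc, mul_assoc, hw'w]

end Ultrafilters

section CarlsonSimpson

variable {α β : Type*}

/-- Substitution of the letter `a` for the variable `none`. -/
def substVar (a : α) (x : List (Option α)) : List α := x.map (·.getD a)

/-- The substitution instance, along a word, of the left variable words `v ++ u n`, where `v` is
the variable. -/
def carlsonSimpson (u : ℕ → List (Option α)) : ℕ → List α → List α
  | _, [] => []
  | n, a :: x => a :: substVar a (u n) ++ carlsonSimpson u (n + 1) x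

theorem carlsonSimpson_concat (u : ℕ → List (Option α)) (n : ℕ) (x : List α) (a : α) :
    carlsonSimpson u n (x ++ [a]) =
      carlsonSimpson u n x ++ a :: substVar a (u (n + x.length)) := by
  induction x generalizing n with
  | nil => simp [carlsonSimpson]
  | cons b x ih => simp [carlsonSimpson, ih, add_left_comm, add_comm]

/-- There are an idempotent ultrafilter on words and an ultrafilter on variable words all of whose
substitution instances are that idempotent. -/
theorem exists_ultrafilter_words (α : Type*) :
    ∃ (w : Ultrafilter (List α)) (v : Ultrafilter (List (Option α))),
      (∀ p : List α → Prop, (∀ᶠ s in w, p s) → ∀ᶠ s in w, ∀ᶠ t in w, p (s ++ t)) ∧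
      (∀ᶠ x : List (Option α) in (v : Filter (List (Option α))), none ∈ x) ∧
      ∀ (a : α) (p : List α → Prop), (∀ᶠ s in w, p s) →
        ∀ᶠ x in (v : Filter (List (Option α))), p (substVar a x) := by
  obtain ⟨w, v, hw, hv, hwv⟩ := exists_ultrafilter_map_eq
    (S := FreeMonoid α) (T := FreeMonoid (Option α))
    (FreeMonoid.map some : FreeMonoid α →* FreeMonoid (Option α)).toMulHom
    (fun a : α => (FreeMonoid.map (fun o : Option α => o.getD a)).toMulHom)
    (fun a s => by
      change FreeMonoid.map _ (FreeMonoid.map _ s) = s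
      rw [FreeMonoid.map_map]
      exact DFunLike.congr_fun FreeMonoid.map_id s)
    {x | none ∈ FreeMonoid.toList x} ⟨FreeMonoid.of none, by simp⟩
    (fun x y hy => by simp_all) (fun x y hy => by simp_all)
  refine ⟨w, v, fun p hp => ?_, hv, fun a p hp => ?_⟩
  · rw [← hw] at hp
    exact hp
  · rw [← hwv a] at hp
    exact hp

theorem exists_eq_append_none_of_mem {x : List (Option α)} (hx : none ∈ x) :
    ∃ (y : List α) (z : List (Option α)), x = y.map some ++ none :: z := by
  induction x with
  | nil => simp at hx
  | cons o x ih =>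
    cases o with
    | none => exact ⟨[], x, rfl⟩
    | some a =>
      obtain ⟨y, z, rfl⟩ := ih (by simpa using hx)
      exact ⟨a :: y, z, rfl⟩

/-- The infinite Hales–Jewett theorem of Carlson and Simpson. -/
theorem exists_carlsonSimpson_eq {κ : Type*} [Finite α] [Finite κ] (c : List α → κ) :
    ∃ (w : List α) (u : ℕ → List (Option α)) (k₀ : κ),
      ∀ x, c (w ++ carlsonSimpson u 0 x) = k₀ := by
  classical
  cases nonempty_fintype α
  obtain ⟨W, V, hW, hV, hWV⟩ := exists_ultrafilter_words α
  choose! y z hyz using fun x : List (Option α) => exists_eq_append_none_of_mem (x := x)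
  have hcol : ∃ k₀, ∀ᶠ s in W, ∀ᶠ x in V, c (s ++ y x) = k₀ := by
    have h1 : ∀ s, ∃ k, ∀ᶠ x in V, c (s ++ y x) = k := fun s =>
      (Ultrafilter.eventually_exists_iff (f := V)).1 (Filter.Eventually.of_forall fun x => ⟨_, rfl⟩)
    exact (Ultrafilter.eventually_exists_iff (f := W)).1 (Filter.Eventually.of_forall h1)
  obtain ⟨k₀, hk₀⟩ := hcol
  let C : Set (List α) := {s | ∀ᶠ x in V, c (s ++ y x) = k₀}
  let G : Set (List α) := {s | s ∈ C ∧ ∀ᶠ t in W, s ++ t ∈ C}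
  have hG : ∀ᶠ s in W, s ∈ G := hk₀.and (hW _ hk₀)
  have hGstep : ∀ s ∈ G, ∀ᶠ x in V, ∀ a, s ++ substVar a x ∈ G := by
    intro s hs
    rw [Filter.eventually_all]
    intro a
    refine hWV a (fun t => s ++ t ∈ G) ?_
    have := hW _ hs.2
    filter_upwards [hs.2, this] with t ht ht'
    exact ⟨ht, by simpa using ht'⟩
  have hnext : ∀ F : {F : Finset (List α) // ∀ s ∈ F, s ∈ G}, ∃ x : List (Option α), none ∈ x ∧
      ∀ s ∈ F.1, c (s ++ y x) = k₀ ∧ ∀ a, s ++ substVar a x ∈ G := by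
    intro F
    refine (hV.and ((Filter.eventually_all_finset F.1).2 fun s hs => ?_)).exists
    exact (F.2 s hs).1.and (hGstep s (F.2 s hs))
  choose N hN1 hN2 using hnext
  let next : {F : Finset (List α) // ∀ s ∈ F, s ∈ G} → {F : Finset (List α) // ∀ s ∈ F, s ∈ G} :=
    fun F => ⟨(F.1 ×ˢ Finset.univ).image fun q : List α × α => q.1 ++ substVar q.2 (N F), by
      intro s hs
      simp only [Finset.mem_image, Finset.mem_product, Finset.mem_univ, and_true,
        Prod.exists] at hs
      obtain ⟨s, a, hs, rfl⟩ := hs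
      exact (hN2 F s hs).2 a⟩
  obtain ⟨s₀, hs₀⟩ := hG.exists
  let F : ℕ → {F : Finset (List α) // ∀ s ∈ F, s ∈ G} :=
    fun n => next^[n] ⟨{s₀}, by simpa using hs₀⟩
  have hF : ∀ n s, s ∈ (F n).1 → ∀ a, s ++ substVar a (N (F n)) ∈ (F (n + 1)).1 := by
    intro n s hs a
    simp only [F, Function.iterate_succ_apply']
    exact Finset.mem_image.2 ⟨(s, a), by simpa [F] using hs, rfl⟩
  refine ⟨s₀ ++ y (N (F 0)), fun n => z (N (F n)) ++ (y (N (F (n + 1)))).map some, k₀,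
    fun x => ?_⟩
  suffices h : ∃ s ∈ (F x.length).1, s₀ ++ y (N (F 0)) ++ carlsonSimpson _ 0 x =
      s ++ y (N (F x.length)) by
    obtain ⟨s, hs, h⟩ := h
    rw [h]
    exact (hN2 _ s hs).1
  induction x using List.reverseRecOn with
  | nil => exact ⟨s₀, by simp [F], by simp [carlsonSimpson]⟩
  | append_singleton x a ih =>
    obtain ⟨s, hs, h⟩ := ih
    refine ⟨_, by simpa using hF _ _ hs a, ?_⟩
    have hsub : substVar a (N (F x.length)) =
        y (N (F x.length)) ++ a :: substVar a (z (N (F x.length))) := by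
      conv_lhs => rw [hyz _ (hN1 (F x.length))]
      simp [substVar, Function.comp_def]
    rw [carlsonSimpson_concat, ← List.append_assoc, h, hsub]
    simp [substVar, Function.comp_def]

theorem map_carlsonSimpson (h : α → β) (u : ℕ → List (Option α)) (n : ℕ) (x : List α) :
    (carlsonSimpson u n x).map h =
      carlsonSimpson (fun m => (u m).map (Option.map h)) n (x.map h) := by
  induction x generalizing n with
  | nil => rfl
  | cons a x ih =>
    simp only [carlsonSimpson, substVar, List.map_cons, List.map_append, List.map_map, ih,
      List.cons_append, List.cons.injEq, List.append_cancel_right_eq, true_and]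
    refine List.map_congr_left fun o _ => ?_
    cases o <;> rfl

theorem length_carlsonSimpson (u : ℕ → List (Option α)) (v : ℕ → List (Option β))
    (h : ∀ n, (u n).length = (v n).length) (n : ℕ)
    {x : List α} {y : List β} (hxy : x.length = y.length) :
    (carlsonSimpson u n x).length = (carlsonSimpson v n y).length := by
  induction x generalizing n y with
  | nil =>
    obtain rfl : y = [] := by simpa using hxy.symm
    rfl
  | cons a x ih =>
    cases y with
    | nil => simp at hxy
    | cons b y => simp [carlsonSimpson, substVar, h, ih (n + 1) (y := y) (by simpa using hxy)]

end CarlsonSimpson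

section StrongEmbeddings

/-- `f` preserves levels and immediate-successor directions for nodes of length at most `k`. -/
def IsStrongUpTo (k : ℕ) (f : List Bool → List Bool) : Prop :=
  (∀ s t, s.length = t.length → s.length ≤ k → (f s).length = (f t).length) ∧
  ∀ s i, s.length < k → f s ++ [i] <+: f (s ++ [i])

/-- `f` is an embedding of the binary tree onto an infinite strong subtree. -/
def IsStrongEmb (f : List Bool → List Bool) : Prop :=
  (∀ s t, s.length = t.length → (f s).length = (f t).length) ∧
  ∀ s i, f s ++ [i] <+: f (s ++ [i])

namespace IsStrongEmb

variable {f g : List Bool → List Bool}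

theorem id : IsStrongEmb id := ⟨fun _ _ h => h, fun _ _ => List.prefix_rfl⟩

theorem isPrefix (hf : IsStrongEmb f) {s t : List Bool} (h : s <+: t) : f s <+: f t := by
  obtain ⟨u, rfl⟩ := h
  induction u using List.reverseRecOn with
  | nil => simp
  | append_singleton u i ih =>
    rw [← List.append_assoc]
    exact ih.trans ((List.prefix_append _ _).trans (hf.2 _ i))

theorem append_isPrefix (hf : IsStrongEmb f) {s t : List Bool} {i : Bool} (h : s ++ [i] <+: t) :
    f s ++ [i] <+: f t :=
  (hf.2 s i).trans (hf.isPrefix h)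

theorem comp (hf : IsStrongEmb f) (hg : IsStrongEmb g) : IsStrongEmb (f ∘ g) :=
  ⟨fun _ _ h => hf.1 _ _ (hg.1 _ _ h), fun s i => hf.append_isPrefix (hg.2 s i)⟩

theorem length_lt (hf : IsStrongEmb f) {s t : List Bool} (h : s.length < t.length) :
    (f s).length < (f t).length := by
  have h1 : (f s).length = (f (t.take s.length)).length := hf.1 _ _ (by simp; omega)
  have h2 : t.take s.length ++ [t[s.length]] <+: t := by
    rw [List.take_concat_get']
    exact List.take_prefix _ _
  have := (hf.append_isPrefix h2).length_le
  simp only [List.length_append, List.length_singleton] at this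
  omega

theorem length_le (hf : IsStrongEmb f) {s t : List Bool} (h : s.length ≤ t.length) :
    (f s).length ≤ (f t).length := by
  rcases h.lt_or_eq with h | h
  · exact (hf.length_lt h).le
  · exact (hf.1 _ _ h).le

theorem lt_of_length_lt (hf : IsStrongEmb f) {s t : List Bool}
    (h : (f s).length < (f t).length) : s.length < t.length :=
  lt_of_not_ge fun h' => h.not_ge (hf.length_le h')

theorem length_eq (hf : IsStrongEmb f) {s t : List Bool} (h : (f s).length = (f t).length) :
    s.length = t.length :=
  le_antisymm (le_of_not_gt fun h' => (hf.length_lt h').ne' h)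
    (le_of_not_gt fun h' => (hf.length_lt h').ne h)

theorem injective (hf : IsStrongEmb f) : Function.Injective f := by
  intro s t h
  have hl := hf.length_eq (congrArg List.length h)
  induction s using List.reverseRecOn generalizing t with
  | nil => exact (List.eq_nil_of_length_eq_zero hl.symm).symm
  | append_singleton s i ih =>
    obtain rfl | ⟨t, j, rfl⟩ := List.eq_nil_or_concat' t
    · simp at hl
    have hl' : s.length = t.length := by simpa using hl
    have h1 : f s ++ [i] = f t ++ [j] :=
      List.IsPrefix.eq_of_length (List.prefix_of_prefix_length_le (hf.2 s i) (h ▸ hf.2 t j)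
        (by simp [hf.1 s t hl'])) (by simp [hf.1 s t hl'])
    obtain ⟨h2, h3⟩ := List.append_inj' h1 rfl
    rw [ih h2 hl', h3]

theorem append_isPrefix_iff (hf : IsStrongEmb f) {s t : List Bool} {i : Bool} :
    f s ++ [i] <+: f t ↔ s ++ [i] <+: t := by
  refine ⟨fun h => ?_, hf.append_isPrefix⟩
  have hlt : s.length < t.length := hf.lt_of_length_lt (by
    have := h.length_le
    simp only [List.length_append, List.length_singleton] at this
    omega)
  have h2 : t.take s.length ++ [t[s.length]] <+: t := by
    rw [List.take_concat_get']
    exact List.take_prefix _ _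
  have hl : (f s).length = (f (t.take s.length)).length := hf.1 _ _ (by simp; omega)
  have h3 : f s ++ [i] = f (t.take s.length) ++ [t[s.length]] :=
    List.IsPrefix.eq_of_length (List.prefix_of_prefix_length_le h (hf.append_isPrefix h2)
        (by simp [hl])) (by simp [hl])
  obtain ⟨h4, h5⟩ := List.append_inj' h3 rfl
  rw [hf.injective h4, h5]
  exact h2

theorem isStrongUpTo (hf : IsStrongEmb f) (k : ℕ) : IsStrongUpTo k f :=
  ⟨fun s t h _ => hf.1 s t h, fun s i _ => hf.2 s i⟩

end IsStrongEmb

/-- The extension of a map defined on nodes of length at most `k` to all nodes. -/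
def extendAbove (k : ℕ) (f : List Bool → List Bool) (s : List Bool) : List Bool :=
  f (s.take k) ++ s.drop k

theorem extendAbove_of_le {k : ℕ} (f : List Bool → List Bool) {s : List Bool}
    (hs : s.length ≤ k) : extendAbove k f s = f s := by
  simp [extendAbove, List.take_of_length_le hs, List.drop_of_length_le hs]

theorem IsStrongUpTo.isStrongEmb_extendAbove {k : ℕ} {f : List Bool → List Bool}
    (hf : IsStrongUpTo k f) : IsStrongEmb (extendAbove k f) := by
  refine ⟨fun s t h => ?_, fun s i => ?_⟩
  · simp only [extendAbove, List.length_append, List.length_drop, h]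
    rw [hf.1 (s.take k) (t.take k) (by simp [h]) (by simp)]
  · rcases lt_or_ge s.length k with h | h
    · rw [extendAbove_of_le f h.le, extendAbove_of_le f (by simpa using h)]
      exact hf.2 s i h
    · simp [extendAbove, List.take_append_of_le_length h, List.drop_append_of_le_length h]

end StrongEmbeddings

section OneStep

variable {κ : Type*}

theorem isPrefix_carlsonSimpson (u : ℕ → List (Option Bool)) (s : List Bool) (i : Bool) :
    carlsonSimpson u 0 s ++ [i] <+: carlsonSimpson u 0 (s ++ [i]) := by
  rw [carlsonSimpson_concat]
  exact ⟨substVar i (u (0 + s.length)), by simp⟩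

/-- Milliken's theorem for strong subtrees of height one. -/
theorem exists_isStrongEmb_root [Finite κ] (c : List Bool → κ) :
    ∃ f, IsStrongEmb f ∧ ∃ k₀, ∀ s, c (f s) = k₀ := by
  obtain ⟨w, u, k₀, h⟩ := exists_carlsonSimpson_eq c
  refine ⟨fun s => w ++ carlsonSimpson u 0 s, ⟨fun s t hst => ?_, fun s i => ?_⟩, k₀, h⟩
  · simp [length_carlsonSimpson u u (fun _ => rfl) 0 hst]
  · rw [List.append_assoc, List.prefix_append_right_inj]
    exact isPrefix_carlsonSimpson u s i

/-- The strong embedding which is the identity on nodes of length at most `n`, and which above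
each node `t` of length `n + 1` follows the `t`-th coordinate of a Carlson–Simpson space. -/
noncomputable def coordEmb (n : ℕ) (w : List ({t : List Bool // t.length = n + 1} → Bool))
    (u : ℕ → List (Option ({t : List Bool // t.length = n + 1} → Bool))) (s : List Bool) :
    List Bool :=
  if h : s.length ≤ n then s else
    let t : {t : List Bool // t.length = n + 1} := ⟨s.take (n + 1), by simp; omega⟩
    t.1 ++ (w.map (· t) ++
      carlsonSimpson (fun m => (u m).map (Option.map (· t))) 0 (s.drop (n + 1)))

section

variable {n : ℕ} (w : List ({t : List Bool // t.length = n + 1} → Bool))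
  (u : ℕ → List (Option ({t : List Bool // t.length = n + 1} → Bool)))

theorem coordEmb_of_le {s : List Bool} (h : s.length ≤ n) : coordEmb n w u s = s := dif_pos h

theorem coordEmb_append (t : {t : List Bool // t.length = n + 1}) (y : List Bool) :
    coordEmb n w u (t.1 ++ y) = t.1 ++ (w.map (· t) ++
      carlsonSimpson (fun m => (u m).map (Option.map (· t))) 0 y) := by
  have h : ¬ (t.1 ++ y).length ≤ n := by simp [t.2]; omega
  have h1 : (t.1 ++ y).take (n + 1) = t.1 := List.take_left' t.2
  have h2 : (t.1 ++ y).drop (n + 1) = y := List.drop_left' t.2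
  rw [coordEmb, dif_neg h]
  simp only [h1, h2, Subtype.coe_eta]

theorem coordEmb_append_map (t : {t : List Bool // t.length = n + 1})
    (x : List ({t : List Bool // t.length = n + 1} → Bool)) :
    coordEmb n w u (t.1 ++ x.map (· t)) = t.1 ++ (w ++ carlsonSimpson u 0 x).map (· t) := by
  rw [coordEmb_append, List.map_append, map_carlsonSimpson]

theorem exists_eq_append_of_lt {s : List Bool} (h : n < s.length) :
    ∃ (t : {t : List Bool // t.length = n + 1}) (y : List Bool), s = t.1 ++ y :=
  ⟨⟨s.take (n + 1), by simp; omega⟩, s.drop (n + 1), by simp⟩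

theorem isStrongEmb_coordEmb : IsStrongEmb (coordEmb n w u) := by
  refine ⟨fun s t h => ?_, fun s i => ?_⟩
  · rcases le_or_gt s.length n with hs | hs
    · rw [coordEmb_of_le w u hs, coordEmb_of_le w u (h ▸ hs), h]
    · obtain ⟨a, y, rfl⟩ := exists_eq_append_of_lt hs
      obtain ⟨b, z, rfl⟩ := exists_eq_append_of_lt (h ▸ hs)
      rw [coordEmb_append, coordEmb_append]
      have hyz : y.length = z.length := by simpa [a.2, b.2] using h
      simp only [List.length_append, a.2, b.2, List.length_map]
      rw [length_carlsonSimpson _ (fun m => (u m).map (Option.map (· b))) (by simp) 0 hyz]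
  · rcases lt_trichotomy s.length n with hs | hs | hs
    · rw [coordEmb_of_le w u hs.le, coordEmb_of_le w u (by simpa using hs)]
    · rw [coordEmb_of_le w u hs.le]
      have := coordEmb_append w u ⟨s ++ [i], by simp [hs]⟩ []
      simp only [List.append_nil] at this
      rw [this]
      exact List.prefix_append _ _
    · obtain ⟨a, y, rfl⟩ := exists_eq_append_of_lt hs
      rw [List.append_assoc a.1, coordEmb_append, coordEmb_append]
      simp only [List.append_assoc, List.prefix_append_right_inj]
      exact isPrefix_carlsonSimpson _ y i

end

/-- If all `g s` with `|s| = k + 1` pass through distinct nodes of length `n + 1` and have the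
same length, then they are read off from one word over the alphabet of level-`(n + 1)` tuples. -/
theorem IsStrongEmb.exists_word {g : List Bool → List Bool} (hg : IsStrongEmb g) {k n : ℕ}
    (hn : ∀ s, s.length = k → (g s).length = n) :
    ∃ x : List ({t : List Bool // t.length = n + 1} → Bool),
      ∀ (s : List Bool) (i : Bool) (hs : s.length = k),
        g (s ++ [i]) = g s ++ [i] ++ x.map (· ⟨g s ++ [i], by simp [hn s hs]⟩) := by
  classical
  let m := (g (List.replicate (k + 1) false)).length - (n + 1)
  have hY : ∀ t : {t : List Bool // t.length = n + 1}, ∃ y : List Bool, y.length = m ∧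
      ∀ (s : List Bool) (i : Bool), s.length = k → g s ++ [i] = t.1 → g (s ++ [i]) = t.1 ++ y := by
    intro t
    by_cases h : ∃ (s : List Bool) (i : Bool), s.length = k ∧ g s ++ [i] = t.1
    · obtain ⟨s, i, hs, ht⟩ := h
      obtain ⟨y, hy⟩ := hg.2 s i
      refine ⟨y, ?_, fun s' i' _ ht' => ?_⟩
      · have h1 := hg.1 (s ++ [i]) (List.replicate (k + 1) false) (by simp [hs])
        rw [← hy] at h1
        simp only [List.length_append, hn s hs, List.length_singleton] at h1
        omega
      · obtain ⟨h1, h2⟩ := List.append_inj' (ht'.trans ht.symm) rfl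
        obtain rfl := hg.injective h1
        simp only [List.cons.injEq, and_true] at h2
        subst h2
        rw [← hy, ht]
    · exact ⟨List.replicate m false, by simp, fun s i hs ht => (h ⟨s, i, hs, ht⟩).elim⟩
  choose Y hYm hYg using hY
  refine ⟨List.ofFn fun (j : Fin m) t => (Y t)[j.1]'(by rw [hYm]; exact j.2), fun s i hs => ?_⟩
  rw [hYg ⟨g s ++ [i], by simp [hn s hs]⟩ s i hs rfl]
  congr 1
  refine List.ext_getElem (by simp [hYm]) fun j h1 h2 => by simp

/-- The step of the fusion: above level `n`, the tree can be thinned out so that the color of a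
strong subtree of height `k + 2` whose last but one level is `n` does not depend on its last
level. -/
theorem exists_isStrongEmb_step [Finite κ] (k n : ℕ) (χ : (List Bool → List Bool) → κ)
    (hχ : ∀ g g' : List Bool → List Bool, (∀ s, s.length ≤ k + 1 → g s = g' s) → χ g = χ g') :
    ∃ e, IsStrongEmb e ∧ (∀ s, s.length ≤ n → e s = s) ∧
      ∀ g g', IsStrongEmb g → IsStrongEmb g' → (∀ s, s.length ≤ k → g s = g' s) →
        (∀ s, s.length = k → (g s).length = n) → χ (e ∘ g) = χ (e ∘ g') := by
  classical
  have : Finite {s : List Bool // s.length ≤ k} := List.finite_length_le Bool k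
  have : Finite {s : List Bool // s.length ≤ n} := List.finite_length_le Bool n
  have : Finite {s : List Bool // s.length = n + 1} := List.finite_length_eq Bool (n + 1)
  let lift (x : List ({t : List Bool // t.length = n + 1} → Bool)) (t : List Bool) : List Bool :=
    if h : t.length = n + 1 then t ++ x.map (· ⟨t, h⟩) else []
  let ext (φ : {s : List Bool // s.length ≤ k} → {s : List Bool // s.length ≤ n})
      (x : List ({t : List Bool // t.length = n + 1} → Bool)) (s : List Bool) : List Bool :=
    if h : s.length ≤ k then φ ⟨s, h⟩ else lift x (φ ⟨s.take k, by simp⟩ ++ s.drop k)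
  obtain ⟨w, u, k₀, h⟩ := exists_carlsonSimpson_eq fun x φ => χ (ext φ x)
  refine ⟨coordEmb n w u, isStrongEmb_coordEmb w u, fun s hs => coordEmb_of_le w u hs,
    fun g g' hg hg' hgg' hn => ?_⟩
  have hle : ∀ s, s.length ≤ k → (g s).length ≤ n := fun s hs => by
    rw [← hn (List.replicate k false) (by simp)]
    exact hg.length_le (by simpa using hs)
  let φ : {s : List Bool // s.length ≤ k} → {s : List Bool // s.length ≤ n} :=
    fun s => ⟨g s.1, hle s.1 s.2⟩
  suffices key : ∀ g', IsStrongEmb g' → (∀ s, s.length ≤ k → g s = g' s) →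
      χ (coordEmb n w u ∘ g') = k₀ φ by
    rw [key g hg fun _ _ => rfl, key g' hg' hgg']
  intro g' hg' hgg'
  obtain ⟨x, hx⟩ := hg'.exists_word (k := k) (n := n) fun s hs => by rw [← hgg' s hs.le, hn s hs]
  rw [← h x]
  refine hχ _ _ fun s hs => ?_
  rcases hs.lt_or_eq with hs | hs
  · have hs' : s.length ≤ k := by omega
    simp only [Function.comp_apply, ext, dif_pos hs', φ]
    rw [← hgg' s hs', coordEmb_of_le w u (hle s hs')]
  · obtain rfl | ⟨s, i, rfl⟩ := List.eq_nil_or_concat' s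
    · simp at hs
    have hs' : s.length = k := by simpa using hs
    have hnk : ¬ (s ++ [i]).length ≤ k := by simp [hs']
    have hlen : (g' s ++ [i]).length = n + 1 := by simp [← hgg' s hs'.le, hn s hs']
    have h1 : (s ++ [i]).take k = s := by rw [← hs', List.take_left]
    have h2 : (s ++ [i]).drop k = [i] := by rw [← hs', List.drop_left]
    simp only [Function.comp_apply, ext, dif_neg hnk, φ, h1, h2, hgg' s hs'.le, lift, dif_pos hlen]
    rw [hx s i hs']
    exact coordEmb_append_map w u ⟨g' s ++ [i], hlen⟩ x

end OneStep

section Fusion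

variable {κ : Type*}

theorem exists_isStrongEmb_fusion [Finite κ] (k : ℕ) (χ : (List Bool → List Bool) → κ)
    (hχ : ∀ g g' : List Bool → List Bool, (∀ s, s.length ≤ k + 1 → g s = g' s) → χ g = χ g') :
    ∃ f, IsStrongEmb f ∧ ∀ g g', IsStrongEmb g → IsStrongEmb g' →
      (∀ s, s.length ≤ k → g s = g' s) → χ (f ∘ g) = χ (f ∘ g') := by
  choose e he hid hcol using fun (n : ℕ) (f : List Bool → List Bool) =>
    exists_isStrongEmb_step k n (fun g => χ (f ∘ g)) fun g g' h =>
      hχ _ _ fun s hs => congrArg f (h s hs)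
  let F : ℕ → List Bool → List Bool := Nat.rec id fun n f => f ∘ e n f
  have hFs : ∀ n, F (n + 1) = F n ∘ e n (F n) := fun n => rfl
  have hF : ∀ n, IsStrongEmb (F n) := fun n => by
    induction n with
    | zero => exact IsStrongEmb.id
    | succ n ih => exact ih.comp (he n _)
  have hfact : ∀ n m, n ≤ m → ∃ e', IsStrongEmb e' ∧ (∀ s, s.length ≤ n → e' s = s) ∧
      F m = F n ∘ e' := by
    intro n m hnm
    induction m, hnm using Nat.le_induction with
    | base => exact ⟨id, IsStrongEmb.id, fun _ _ => rfl, rfl⟩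
    | succ m hnm ih =>
      obtain ⟨e', he', hid', hFm⟩ := ih
      refine ⟨e' ∘ e m (F m), he'.comp (he _ _), fun s hs => ?_, ?_⟩
      · rw [Function.comp_apply, hid m _ s (hs.trans hnm), hid' s hs]
      · rw [hFs, ← Function.comp_assoc, ← hFm]
  have hstable : ∀ (s : List Bool) (m : ℕ), s.length ≤ m → F m s = F s.length s := by
    intro s m hs
    obtain ⟨e', -, hid', h⟩ := hfact _ _ hs
    rw [h, Function.comp_apply, hid' s le_rfl]
  refine ⟨fun s => F s.length s, ⟨fun s t h => ?_, fun s i => ?_⟩, fun g g' hg hg' hgg' => ?_⟩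
  · simp only [h]
    exact (hF _).1 s t h
  · simp only
    rw [← hstable s (s ++ [i]).length (by simp)]
    exact (hF _).2 s i
  · let n := (g (List.replicate k false)).length
    let M := max (max (g (List.replicate (k + 1) false)).length
      (g' (List.replicate (k + 1) false)).length) (n + 1)
    have hM : ∀ γ, IsStrongEmb γ → (γ (List.replicate (k + 1) false)).length ≤ M →
        χ ((fun s => F s.length s) ∘ γ) = χ (F M ∘ γ) := fun γ hγ hle =>
      hχ _ _ fun s hs => (hstable _ _ (le_trans (hγ.length_le (by simpa using hs)) hle)).symm
    rw [hM g hg ((le_max_left _ _).trans (le_max_left _ _)),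
      hM g' hg' ((le_max_right _ _).trans (le_max_left _ _))]
    obtain ⟨e', he', hid', h⟩ := hfact (n + 1) M (le_max_right _ _)
    rw [h, hFs, Function.comp_assoc, Function.comp_assoc, Function.comp_assoc, Function.comp_assoc]
    refine hcol n (F n) _ _ (he'.comp hg) (he'.comp hg') (fun s hs => ?_) fun s hs => ?_
    · simp only [Function.comp_apply, hgg' s hs]
    · have : (g s).length = n := hg.1 _ _ (by simpa using hs)
      rw [Function.comp_apply, hid' _ (by omega), this]

/-- Milliken's theorem, in terms of strong embeddings. -/
theorem exists_isStrongEmb_milliken [Finite κ] (k : ℕ) (χ : (List Bool → List Bool) → κ)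
    (hχ : ∀ g g' : List Bool → List Bool, (∀ s, s.length ≤ k → g s = g' s) → χ g = χ g') :
    ∃ f, IsStrongEmb f ∧ ∃ k₀, ∀ g, IsStrongEmb g → χ (f ∘ g) = k₀ := by
  induction k generalizing χ with
  | zero =>
    obtain ⟨f, hf, k₀, h⟩ := exists_isStrongEmb_root fun x => χ fun _ => x
    refine ⟨f, hf, k₀, fun g _ => ?_⟩
    rw [← h (g [])]
    refine hχ _ _ fun s hs => ?_
    rw [List.eq_nil_of_length_eq_zero (Nat.le_zero.1 hs), Function.comp_apply]
  | succ k ih =>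
    obtain ⟨f, hf, hcol⟩ := exists_isStrongEmb_fusion k χ hχ
    obtain ⟨h, hh, k₀, hk₀⟩ := ih (fun φ => χ (f ∘ extendAbove k φ)) fun g g' hgg' => by
      congr 2
      ext1 s
      rw [extendAbove, extendAbove, hgg' _ (by simp)]
    refine ⟨f ∘ h, hf.comp hh, k₀, fun g hg => ?_⟩
    rw [← hk₀ g hg, Function.comp_assoc]
    exact hcol _ _ (hh.comp hg) ((hh.comp hg).isStrongUpTo k).isStrongEmb_extendAbove
      fun s hs => (extendAbove_of_le _ hs).symm

end Fusion

section Subtrees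

/-- The range of a strong embedding is a strong subtree. -/
theorem IsStrongEmb.isStrongSubtree_range {f : List Bool → List Bool} (hf : IsStrongEmb f) :
    IsStrongSubtree (Set.range f) (Set.range fun s => (f s).length) := by
  refine ⟨?_, ?_, ⟨f [], ⟨⟨[], rfl⟩, ?_⟩, ?_⟩, ?_, ?_⟩
  · rintro _ ⟨s, rfl⟩
    exact ⟨s, rfl⟩
  · rintro _ ⟨s, rfl⟩
    exact ⟨f s, ⟨s, rfl⟩, rfl⟩
  · rintro _ ⟨s, rfl⟩
    exact hf.length_le (by simp)
  · rintro _ ⟨⟨s, rfl⟩, hs⟩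
    have h : s.length = ([] : List Bool).length :=
      hf.length_eq (le_antisymm (hs _ ⟨[], rfl⟩) (hf.length_le (by simp)))
    rw [List.eq_nil_of_length_eq_zero h]
  · rintro _ ⟨s, rfl⟩ _ ⟨t, rfl⟩ hlt hleast i
    simp only at hlt hleast
    have h1 := hleast _ ⟨s ++ [i], rfl⟩ (hf.length_lt (by simp))
    have h2 : (f (s ++ [i])).length = (f t).length :=
      le_antisymm (hf.length_le (by simpa using hf.lt_of_length_lt hlt)) h1
    refine ⟨f (s ++ [i]), ⟨⟨_, rfl⟩, h2, hf.2 s i⟩, ?_⟩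
    rintro _ ⟨⟨y, rfl⟩, hy, hpre⟩
    rw [(hf.append_isPrefix_iff.1 hpre).eq_of_length (hf.length_eq (h2.trans hy.symm))]
  · rintro _ ⟨t, rfl⟩ ⟨_, ⟨u, rfl⟩, hu⟩
    obtain rfl | ⟨s, i, rfl⟩ := List.eq_nil_or_concat' t
    · exact absurd (hf.lt_of_length_lt hu) (by simp)
    refine ⟨f s, ⟨s, rfl⟩, i, hf.2 s i, hf.length_lt (by simp), ?_⟩
    rintro _ ⟨y, rfl⟩ hy
    exact hf.length_le (by simpa using hf.lt_of_length_lt hy)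

/-- A strong subtree of height `k + 1` is the image of the nodes of length at most `k`. -/
theorem IsStrongSubtree.exists_eq_image {T : Set (List Bool)} {B : Set ℕ}
    (hT : IsStrongSubtree T B) {k : ℕ} (hB : B.Finite) (hk : B.ncard = k + 1) :
    ∃ h, IsStrongUpTo k h ∧ T = h '' {s | s.length ≤ k} := by
  obtain ⟨hlen, hreal, ⟨root, ⟨hroot, hmin⟩, huniq⟩, hsucc, hpred⟩ := hT
  have hcard : ∀ hf : {x | x ∈ B}.Finite, hf.toFinset.card = k + 1 := fun hf => by
    rw [← hk]
    exact (Set.ncard_eq_toFinset_card _ hf).symm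
  let b : ℕ → ℕ := Nat.nth (· ∈ B)
  have hbB : ∀ n, n ≤ k → b n ∈ B := fun n hn =>
    Nat.nth_mem n fun hf => (Nat.lt_succ_of_le hn).trans_eq (hcard hf).symm
  have hblt : ∀ m n, m < n → n ≤ k → b m < b n := fun m n hmn hn =>
    Nat.nth_lt_nth' hmn fun hf => (Nat.lt_succ_of_le hn).trans_eq (hcard hf).symm
  have hble : ∀ m n, m ≤ n → n ≤ k → b m ≤ b n := fun m n hmn hn => by
    rcases hmn.lt_or_eq with h | rfl
    · exact (hblt m n h hn).le
    · exact le_rfl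
  have hbsurj : ∀ a ∈ B, ∃ n ≤ k, b n = a := fun a ha => by
    have hB' : {x | x ∈ B}.Finite := hB
    obtain ⟨n, hn, hna⟩ := Nat.exists_lt_card_finite_nth_eq (p := (· ∈ B)) hB' ha
    exact ⟨n, Nat.lt_succ_iff.1 (hn.trans_eq (hcard hB')), hna⟩
  have hnext : ∀ n, n + 1 ≤ k → ∀ a ∈ B, b n < a → b (n + 1) ≤ a := by
    intro n hn a ha hlt
    obtain ⟨m, hm, rfl⟩ := hbsurj a ha
    refine hble _ _ (Nat.lt_of_not_le fun hmn => ?_) hm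
    exact hlt.not_ge (hble m n hmn (by omega))
  have hrootlen : root.length = b 0 := by
    obtain ⟨n, hn, hbn⟩ := hbsurj _ (hlen root hroot)
    obtain ⟨s, hs, hs0⟩ := hreal _ (hbB 0 (by omega))
    exact le_antisymm (hs0 ▸ hmin s hs) (hbn ▸ hble 0 n (by omega) hn)
  have hstep : ∀ s i, ∃ t, ∀ n, n + 1 ≤ k → s ∈ T → s.length = b n →
      t ∈ T ∧ t.length = b (n + 1) ∧ s ++ [i] <+: t ∧
        ∀ t' ∈ T, t'.length = b (n + 1) → s ++ [i] <+: t' → t' = t := by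
    intro s i
    by_cases h : ∃ n, n + 1 ≤ k ∧ s ∈ T ∧ s.length = b n
    · obtain ⟨n, hn, hs, hsn⟩ := h
      obtain ⟨t, ⟨ht, htl, hpre⟩, hu⟩ := hsucc s hs (b (n + 1)) (hbB _ hn)
        (hsn ▸ hblt _ _ (by omega) hn) (fun a ha hlt => hnext n hn a ha (hsn ▸ hlt)) i
      refine ⟨t, fun m hm _ hsm => ?_⟩
      obtain rfl : n = m := by
        rcases lt_trichotomy n m with h | h | h
        · have := hblt _ _ h (by omega)
          omega
        · exact h
        · have := hblt _ _ h (by omega)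
          omega
      exact ⟨ht, htl, hpre, fun t' h1 h2 h3 => hu t' ⟨h1, h2, h3⟩⟩
    · exact ⟨[], fun n hn hs hsn => (h ⟨n, hn, hs, hsn⟩).elim⟩
  choose step hstepT using hstep
  let h : List Bool → List Bool := fun s => s.foldl step root
  have hconcat : ∀ s i, h (s ++ [i]) = step (h s) i := fun s i => by
    simp only [h, List.foldl_append, List.foldl_cons, List.foldl_nil]
  have hmem : ∀ s, s.length ≤ k → h s ∈ T ∧ (h s).length = b s.length := by
    intro s
    induction s using List.reverseRecOn with
    | nil => exact fun _ => ⟨hroot, hrootlen⟩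
    | append_singleton s i ih =>
      intro hs
      rw [List.length_append, List.length_singleton] at hs ⊢
      obtain ⟨h1, h2⟩ := ih (by omega)
      rw [hconcat]
      have := hstepT (h s) i s.length hs h1 h2
      exact ⟨this.1, this.2.1⟩
  refine ⟨h, ⟨fun s t hst hs => ?_, fun s i hs => ?_⟩, Set.Subset.antisymm ?_ ?_⟩
  · rw [(hmem s hs).2, (hmem t (hst ▸ hs)).2, hst]
  · obtain ⟨h1, h2⟩ := hmem s hs.le
    rw [hconcat]
    exact (hstepT (h s) i s.length hs h1 h2).2.2.1
  · have hsurj : ∀ n, n ≤ k → ∀ t ∈ T, t.length = b n → ∃ s, s.length = n ∧ h s = t := by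
      intro n
      induction n with
      | zero =>
        intro _ t ht htl
        refine ⟨[], rfl, (huniq t ⟨ht, fun t' ht' => ?_⟩).symm⟩
        rw [htl, ← hrootlen]
        exact hmin t' ht'
      | succ n ih =>
        intro hn t ht htl
        obtain ⟨s, hs, i, hpre, hlt, hnone⟩ := hpred t ht
          ⟨root, hroot, by rw [hrootlen, htl]; exact hblt _ _ (by omega) hn⟩
        obtain ⟨m, hm, hsm⟩ := hbsurj _ (hlen s hs)
        have hmn : m = n := by
          refine le_antisymm (Nat.le_of_not_lt fun h' => ?_) (Nat.le_of_not_lt fun h' => ?_)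
          · have : b (n + 1) ≤ b m := hble _ _ h' hm
            omega
          · have h1 := hnone (b (m + 1)) (hbB _ (by omega)) (hsm ▸ hblt _ _ (by omega) (by omega))
            have h2 := hblt (m + 1) (n + 1) (by omega) hn
            omega
        subst hmn
        obtain ⟨x, hx, rfl⟩ := ih hm s hs hsm.symm
        refine ⟨x ++ [i], by simp [hx], ?_⟩
        rw [hconcat]
        exact ((hstepT (h x) i m hn hs hsm.symm).2.2.2 t ht htl hpre).symm
    intro t ht
    obtain ⟨n, hn, hbn⟩ := hbsurj _ (hlen t ht)
    obtain ⟨s, hs, rfl⟩ := hsurj n hn t ht hbn.symm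
    exact ⟨s, by simpa [hs] using hn, rfl⟩
  · rintro _ ⟨s, hs, rfl⟩
    exact (hmem s hs).1

end Subtrees

/-- Milliken's theorem for strong trees (binary case): for every `k ≥ 1`, `r ≥ 1`,
and every `r`-coloring of the strong subtrees of `2^{<ω}` of height `k`, there is an
infinite strong subtree `S` of `2^{<ω}`, with infinite level set `A`, such that all
strong subtrees of height `k` whose nodes lie in `S` and whose (k-element) level sets
lie in `A` receive the same color. -/
theorem milliken_strong_trees (k r : ℕ) (hk : 1 ≤ k) (hr : 1 ≤ r)
    (c : Set (List Bool) → Fin r) :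
    ∃ (S : Set (List Bool)) (A : Set ℕ), A.Infinite ∧ IsStrongSubtree S A ∧
      ∃ k₀ : Fin r, ∀ (T : Set (List Bool)) (B : Set ℕ),
        B.Finite → B.ncard = k → B ⊆ A → T ⊆ S → IsStrongSubtree T B →
        c T = k₀ := by
  obtain ⟨k, rfl⟩ : ∃ m, k = m + 1 := ⟨k - 1, by omega⟩
  obtain ⟨f, hf, k₀, hk₀⟩ := exists_isStrongEmb_milliken k
    (fun g => c (g '' {s | s.length ≤ k})) fun g g' h => congrArg c (Set.image_congr h)
  refine ⟨Set.range f, Set.range fun s => (f s).length, ?_, hf.isStrongSubtree_range, k₀,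
    fun T B hBfin hBk _ hTS hT => ?_⟩
  · refine Set.infinite_of_injective_forall_mem
      (f := fun n => (f (List.replicate n false)).length) (fun m n h => ?_) fun n => ⟨_, rfl⟩
    simpa using hf.length_eq h
  · obtain ⟨h, hh, rfl⟩ := hT.exists_eq_image hBfin hBk
    have hinv : ∀ s : List Bool, ∃ t, s.length ≤ k → f t = h s := fun s => by
      by_cases hs : s.length ≤ k
      · obtain ⟨t, ht⟩ := hTS ⟨s, hs, rfl⟩
        exact ⟨t, fun _ => ht⟩
      · exact ⟨[], fun hs' => (hs hs').elim⟩
    choose g hg using hinv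
    have hgs : IsStrongUpTo k g := by
      refine ⟨fun s t hst hs => hf.length_eq ?_, fun s i hs => hf.append_isPrefix_iff.1 ?_⟩
      · rw [hg s hs, hg t (hst ▸ hs)]
        exact hh.1 s t hst hs
      · rw [hg s hs.le, hg (s ++ [i]) (by simpa using hs)]
        exact hh.2 s i hs
    rw [← hk₀ _ hgs.isStrongEmb_extendAbove]
    refine congrArg c (Set.image_congr fun s hs => ?_)
    rw [Function.comp_apply, extendAbove_of_le g hs, hg s hs]
end
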